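/- arXiv:1608.02418 — 2 statements merged into one kernel-verified Lean document; each statement's English description precedes it below -/
import Mathlib

section
/- Let C be an algebra of global dimension 2, E = Ext^2_C(DC,C), and B = C ⋉ E. For a C-module M, τ_C M ≅ τ_B M (as B-modules) if and only if pd_C τ_C M ≤ 1 and id_C M ≤ 1. -/
open CategoryTheory MulOpposite

open CategoryTheory MulOpposite

/-! Core definitions: right `A`-modules are modules over `Aᵐᵒᵖ`. -/

/-- The category of (small) modules over a ring `R`.  For a `k`-algebra `A`,
right `A`-modules are `Mdl Aᵐᵒᵖ`. -/
abbrev Mdl (R : Type) [Ring R] := ModuleCat.{0} R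

section Generic

variable (R : Type) [Ring R]

/-- `f : P → M` is a projective cover: `P` projective, `f` surjective with
superfluous kernel. -/
def IsProjCover {P M : Mdl R} (f : P →ₗ[R] M) : Prop :=
  Module.Projective R P ∧ Function.Surjective f ∧
    ∀ N : Submodule R P, N ⊔ LinearMap.ker f = ⊤ → N = ⊤

/-- `f : M → I` is an injective envelope: `I` injective, `f` injective with
essential image. -/
def IsInjEnv {M I : Mdl R} (f : M →ₗ[R] I) : Prop :=
  Module.Injective R I ∧ Function.Injective f ∧
    ∀ K : Submodule R I, K ⊓ LinearMap.range f = ⊥ → K = ⊥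

/-- `Hom_R(X, Y) = 0`. -/
def HomZero (X Y : Mdl R) : Prop := ∀ f : X →ₗ[R] Y, f = 0

/-- `X ∈ Gen M`: `X` is an epimorphic image of a finite direct sum of copies of `M`. -/
def MemGen (M X : Mdl R) : Prop :=
  ∃ (d : ℕ) (f : (Fin d → M) →ₗ[R] X), Function.Surjective f

/-- `X ∈ add M`: `X` is a direct summand of a finite direct sum of copies of `M`. -/
def MemAdd (M X : Mdl R) : Prop :=
  ∃ (n : ℕ) (s : X →ₗ[R] (Fin n → M)) (r : (Fin n → M) →ₗ[R] X),
    r.comp s = LinearMap.id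

/-- projective dimension at most 1: a length-one projective resolution exists. -/
def PdLE1 (M : Mdl R) : Prop :=
  ∃ (P1 P0 : Mdl R) (d1 : P1 →ₗ[R] P0) (d0 : P0 →ₗ[R] M),
    Module.Projective R P1 ∧ Module.Projective R P0 ∧
    Function.Injective d1 ∧ Function.Surjective d0 ∧
    LinearMap.range d1 = LinearMap.ker d0

/-- projective dimension at most 2. -/
def PdLE2 (M : Mdl R) : Prop :=
  ∃ (P2 P1 P0 : Mdl R) (d2 : P2 →ₗ[R] P1) (d1 : P1 →ₗ[R] P0) (d0 : P0 →ₗ[R] M),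
    Module.Projective R P2 ∧ Module.Projective R P1 ∧ Module.Projective R P0 ∧
    Function.Injective d2 ∧ Function.Surjective d0 ∧
    LinearMap.range d2 = LinearMap.ker d1 ∧ LinearMap.range d1 = LinearMap.ker d0

/-- injective dimension at most 1. -/
def IdLE1 (M : Mdl R) : Prop :=
  ∃ (I0 I1 : Mdl R) (d0 : M →ₗ[R] I0) (d1 : I0 →ₗ[R] I1),
    Module.Injective R I0 ∧ Module.Injective R I1 ∧
    Function.Injective d0 ∧ Function.Surjective d1 ∧
    LinearMap.range d0 = LinearMap.ker d1

/-- global dimension at most 2 (every module has projective dimension ≤ 2). -/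
def GlDimLE2 : Prop := ∀ M : Mdl R, PdLE2 R M

/-- global dimension exactly 2. -/
def GlDimEq2 : Prop := GlDimLE2 R ∧ ¬ ∀ M : Mdl R, PdLE1 R M

/-- `W` is a first syzygy `Ω M` of `M` (kernel of a projective cover). -/
def IsSyzygy (M W : Mdl R) : Prop :=
  ∃ (P : Mdl R) (f : P →ₗ[R] M), IsProjCover R f ∧
    Nonempty (W ≃ₗ[R] LinearMap.ker f)

/-- `W` is a first cosyzygy `Ω⁻¹ M` of `M` (cokernel of an injective envelope). -/
def IsCosyzygy (M W : Mdl R) : Prop :=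
  ∃ (I : Mdl R) (f : M →ₗ[R] I), IsInjEnv R f ∧
    Nonempty (W ≃ₗ[R] (I ⧸ LinearMap.range f))

/-- `P1 --d1--> P0 --d0--> M → 0` is a minimal projective presentation. -/
def IsMinPres {P1 P0 M : Mdl R} (d1 : P1 →ₗ[R] P0) (d0 : P0 →ₗ[R] M) : Prop :=
  IsProjCover R d0 ∧ Module.Projective R P1 ∧
  LinearMap.range d1 = LinearMap.ker d0 ∧
  ∀ N : Submodule R P1, N ⊔ LinearMap.ker d1 = ⊤ → N = ⊤

/-- `Ext¹_R(X, Y) = 0`, expressed as: every short exact sequence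
`0 → Y → Z → X → 0` splits. -/
def Ext1Zero (X Y : Mdl R) : Prop :=
  ∀ (Z : Mdl R) (i : Y →ₗ[R] Z) (p : Z →ₗ[R] X),
    Function.Injective i → Function.Surjective p →
    LinearMap.range i = LinearMap.ker p →
    ∃ s : X →ₗ[R] Z, p.comp s = LinearMap.id

/-- partial tilting module: `pd ≤ 1` and `Ext¹(M,M) = 0`. -/
def PartialTilting (M : Mdl R) : Prop := PdLE1 R M ∧ Ext1Zero R M M

/-- tilting module: partial tilting plus a coresolution
`0 → R → T' → T'' → 0` with `T', T'' ∈ add M` of the regular module. -/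
def IsTilting (M : Mdl R) : Prop :=
  PartialTilting R M ∧
  ∃ (T' T'' : Mdl R) (i : ModuleCat.of R R →ₗ[R] T') (p : T' →ₗ[R] T''),
    MemAdd R M T' ∧ MemAdd R M T'' ∧
    Function.Injective i ∧ Function.Surjective p ∧
    LinearMap.range i = LinearMap.ker p

/-- an indecomposable (nonzero) module. -/
def Indecomp (M : Mdl R) : Prop :=
  Nontrivial M ∧ ∀ (U V : Submodule R M), IsCompl U V → U = ⊥ ∨ V = ⊥

/-- the number of isomorphism classes of simple `R`-modules is `n`. -/
def SimpleCount (n : ℕ) : Prop :=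
  ∃ S : Fin n → Mdl R,
    (∀ i, IsSimpleModule R (S i)) ∧
    (∀ i j, Nonempty ((S i) ≃ₗ[R] (S j)) → i = j) ∧
    ∀ X : Mdl R, IsSimpleModule R X → ∃ i, Nonempty (X ≃ₗ[R] S i)

end Generic

section Duality

variable (k : Type) [Field k] (A : Type) [Ring A] [Algebra k A]

/-- `N` (a right `A`-module) is the `k`-linear dual `D M` of the left `A`-module `M`:
witnessed by a nondegenerate balanced `k`-bilinear pairing. -/
def IskDual (N : Mdl Aᵐᵒᵖ) (M : Mdl A) : Prop :=
  ∃ φ : N → M → k,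
    (∀ n n' m, φ (n + n') m = φ n m + φ n' m) ∧
    (∀ n m m', φ n (m + m') = φ n m + φ n m') ∧
    (∀ (c : k) n m, φ n ((algebraMap k A c) • m) = c * φ n m) ∧
    (∀ (a : A) n m, φ (op a • n) m = φ n (a • m)) ∧
    (∀ n, (∀ m, φ n m = 0) → n = 0) ∧
    (∀ m, (∀ n, φ n m = 0) → m = 0)

/-- `T = τ M`: the Auslander–Reiten translate of the right `A`-module `M`,
i.e. the `k`-dual of the transpose `Tr M` computed from a minimal projective
presentation. -/
def IsTau (M T : Mdl Aᵐᵒᵖ) : Prop :=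
  ∃ (P1 P0 : Mdl Aᵐᵒᵖ) (d1 : P1 →ₗ[Aᵐᵒᵖ] P0) (d0 : P0 →ₗ[Aᵐᵒᵖ] M),
    IsMinPres Aᵐᵒᵖ d1 d0 ∧
    ∃ (Tr : Mdl A) (q : (P1 →ₗ[Aᵐᵒᵖ] A) →ₗ[A] Tr),
      Function.Surjective q ∧
      (∀ g : P1 →ₗ[Aᵐᵒᵖ] A, q g = 0 ↔ ∃ f : P0 →ₗ[Aᵐᵒᵖ] A, g = f.comp d1) ∧
      IskDual k A T Tr

/-- `T = τ⁻¹ M`: the inverse Auslander–Reiten translate, `Tr (D M)`, computed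
from a minimal projective presentation of the left module `D M`. -/
def IsTauInv (M T : Mdl Aᵐᵒᵖ) : Prop :=
  ∃ (DM : Mdl A), IskDual k A M DM ∧
  ∃ (Q1 Q0 : Mdl A) (d1 : Q1 →ₗ[A] Q0) (d0 : Q0 →ₗ[A] DM),
    IsMinPres A d1 d0 ∧
    ∃ q : (Q1 →ₗ[A] A) →ₗ[Aᵐᵒᵖ] T,
      Function.Surjective q ∧
      ∀ g : Q1 →ₗ[A] A, q g = 0 ↔ ∃ f : Q0 →ₗ[A] A, g = f.comp d1

/-- `W = τ⁻¹ Ω⁻¹ M`. -/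
def IsTauInvCosyz (M W : Mdl Aᵐᵒᵖ) : Prop :=
  ∃ V, IsCosyzygy Aᵐᵒᵖ M V ∧ IsTauInv k A V W

/-- `W = τ Ω M`. -/
def IsTauSyz (M W : Mdl Aᵐᵒᵖ) : Prop :=
  ∃ V, IsSyzygy Aᵐᵒᵖ M V ∧ IsTau k A V W

/-- `M` is `τ`-rigid: `Hom(M, τM) = 0`. -/
def TauRigid (M : Mdl Aᵐᵒᵖ) : Prop :=
  ∀ T, IsTau k A M T → HomZero Aᵐᵒᵖ M T

/-- `M` is `τ`-tilting: `τ`-rigid with as many pairwise nonisomorphic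
indecomposable summands as there are simple modules. -/
def TauTilting (M : Mdl Aᵐᵒᵖ) : Prop :=
  TauRigid k A M ∧
  ∃ (n : ℕ) (N : Fin n → Mdl Aᵐᵒᵖ),
    (∀ i, Indecomp Aᵐᵒᵖ (N i)) ∧
    (∀ i j, Nonempty ((N i) ≃ₗ[Aᵐᵒᵖ] (N j)) → i = j) ∧
    Nonempty (M ≃ₗ[Aᵐᵒᵖ] ((i : Fin n) → N i)) ∧
    SimpleCount Aᵐᵒᵖ n

end Duality


section SplitExt

variable {B C : Type} [Ring B] [Ring C]

/-- a right `C`-module viewed as a right `B`-module via a ring hom `π : B → C`. -/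
def modAlong (π : B →+* C) (M : Mdl Cᵐᵒᵖ) : Mdl Bᵐᵒᵖ :=
  letI : Module Bᵐᵒᵖ M := Module.compHom M (RingHom.op π)
  ModuleCat.of _ M

/-- `X` is the induced module `M ⊗_C B` along `σ : C → B`, characterized by the
universal property of induction (extension of scalars). -/
def IsInducedAlong (σ : C →+* B) (M : Mdl Cᵐᵒᵖ) (X : Mdl Bᵐᵒᵖ) : Prop :=
  ∃ φ : M →+ X,
    (∀ (c : C) (m : M), φ (op c • m) = op (σ c) • φ m) ∧
    ∀ (Y : Mdl Bᵐᵒᵖ) (ψ : M →+ Y),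
      (∀ (c : C) (m : M), ψ (op c • m) = op (σ c) • ψ m) →
      ∃! h : X →ₗ[Bᵐᵒᵖ] Y, ∀ m, h (φ m) = ψ m

/-- `X` is the coinduced module `D(B ⊗_C D M) ≅ Hom_C(B, M)` along `σ : C → B`,
characterized by the universal property of coinduction. -/
def IsCoinducedAlong (σ : C →+* B) (M : Mdl Cᵐᵒᵖ) (X : Mdl Bᵐᵒᵖ) : Prop :=
  ∃ p : X →+ M,
    (∀ (c : C) (x : X), p (op (σ c) • x) = op c • p x) ∧
    ∀ (Y : Mdl Bᵐᵒᵖ) (ψ : Y →+ M),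
      (∀ (c : C) (y : Y), ψ (op (σ c) • y) = op c • ψ y) →
      ∃! h : Y →ₗ[Bᵐᵒᵖ] X, ∀ y, p (h y) = ψ y

end SplitExt

section TrivExt

variable (C : Type) [Ring C] (E : Type) [AddCommGroup E]
  [Module C E] [Module Cᵐᵒᵖ E] [SMulCommClass C Cᵐᵒᵖ E]

/-- the projection `B = C ⋉ E → C` as a ring hom. -/
def tszeFst : TrivSqZeroExt C E →+* C where
  toFun := TrivSqZeroExt.fst
  map_one' := rfl
  map_mul' _ _ := rfl
  map_zero' := rfl
  map_add' _ _ := rfl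

/-- the inclusion `σ : C → B = C ⋉ E` as a ring hom. -/
def tszeInl : C →+* TrivSqZeroExt C E where
  toFun := TrivSqZeroExt.inl
  map_one' := rfl
  map_mul' x y := TrivSqZeroExt.inl_mul (M := E) x y
  map_zero' := TrivSqZeroExt.inl_zero (M := E)
  map_add' x y := TrivSqZeroExt.inl_add (M := E) x y

/-- a right `C`-module viewed as a module over the trivial extension `C ⋉ E`. -/
def modB (M : Mdl Cᵐᵒᵖ) : Mdl (TrivSqZeroExt C E)ᵐᵒᵖ :=
  modAlong (tszeFst C E) M

/-- `X = M ⊗_C B` for `B = C ⋉ E`. -/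
def IsInduced (M : Mdl Cᵐᵒᵖ) (X : Mdl (TrivSqZeroExt C E)ᵐᵒᵖ) : Prop :=
  IsInducedAlong (tszeInl C E) M X

/-- `X = D(B ⊗_C D M)` for `B = C ⋉ E`. -/
def IsCoinduced (M : Mdl Cᵐᵒᵖ) (X : Mdl (TrivSqZeroExt C E)ᵐᵒᵖ) : Prop :=
  IsCoinducedAlong (tszeInl C E) M X

end TrivExt

section RelExt

variable (k : Type) [Field k] (C : Type) [Ring C] [Algebra k C]
  (E : Type) [AddCommGroup E] [Module C E] [Module Cᵐᵒᵖ E]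

/-- The `C`-`C`-bimodule `E` is `Ext²_C(DC, C)`: there is a projective
resolution `0 → P2 → P1 → P0 → DC → 0` of the right module `DC = Hom_k(C,k)`
(characterized by a nondegenerate balanced pairing `φ` with `C`), and `E` is
the cokernel of `Hom_C(P1, C) → Hom_C(P2, C)` as a left `C`-module, with the
right `C`-action on `E` induced (contravariantly, via lifts of the left action
on `DC`) by functoriality of `Ext²(-, C)`. -/
def IsRelExt : Prop :=
  ∃ (DC : Mdl Cᵐᵒᵖ) (φ : DC → C → k),
    (∀ n n' m, φ (n + n') m = φ n m + φ n' m) ∧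
    (∀ n m m', φ n (m + m') = φ n m + φ n m') ∧
    (∀ (c : k) n m, φ n ((algebraMap k C c) * m) = c * φ n m) ∧
    (∀ (a : C) n m, φ (op a • n) m = φ n (a * m)) ∧
    (∀ n, (∀ m, φ n m = 0) → n = 0) ∧
    (∀ m, (∀ n, φ n m = 0) → m = 0) ∧
    ∃ (P2 P1 P0 : Mdl Cᵐᵒᵖ) (d2 : P2 →ₗ[Cᵐᵒᵖ] P1) (d1 : P1 →ₗ[Cᵐᵒᵖ] P0)
      (d0 : P0 →ₗ[Cᵐᵒᵖ] DC),
      Module.Projective Cᵐᵒᵖ P2 ∧ Module.Projective Cᵐᵒᵖ P1 ∧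
      Module.Projective Cᵐᵒᵖ P0 ∧
      Function.Injective d2 ∧ Function.Surjective d0 ∧
      LinearMap.range d2 = LinearMap.ker d1 ∧
      LinearMap.range d1 = LinearMap.ker d0 ∧
      ∃ q : (P2 →ₗ[Cᵐᵒᵖ] C) →ₗ[C] E,
        Function.Surjective q ∧
        (∀ g : P2 →ₗ[Cᵐᵒᵖ] C, q g = 0 ↔ ∃ f : P1 →ₗ[Cᵐᵒᵖ] C, g = f.comp d2) ∧
        ∀ c : C, ∃ (μ : DC →ₗ[Cᵐᵒᵖ] DC) (f0 : P0 →ₗ[Cᵐᵒᵖ] P0)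
            (f1 : P1 →ₗ[Cᵐᵒᵖ] P1) (f2 : P2 →ₗ[Cᵐᵒᵖ] P2),
          (∀ n x, φ (μ n) x = φ n (x * c)) ∧
          d0.comp f0 = μ.comp d0 ∧
          d1.comp f1 = f0.comp d1 ∧
          d2.comp f2 = f1.comp d2 ∧
          ∀ g : P2 →ₗ[Cᵐᵒᵖ] C, q (g.comp f2) = op c • q g

end RelExt


open CategoryTheory MulOpposite

namespace RelExtProof

/-- lifting along a surjection for maps semilinear over a ring homomorphism. -/
theorem semilin_lift {R S : Type} [Ring R] [Ring S] (σ : R →+* S)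
    {Q X Y : Type} [AddCommGroup Q] [AddCommGroup X] [AddCommGroup Y]
    [Module R Q] [Module S X] [Module S Y] [Module.Projective R Q]
    (p : X →ₗ[S] Y) (hp : Function.Surjective p) (f : Q →ₛₗ[σ] Y) :
    ∃ g : Q →ₛₗ[σ] X, ∀ x, p (g x) = f x := by
  let _ : Module R X := Module.compHom X σ
  let _ : Module R Y := Module.compHom Y σ
  let p' : X →ₗ[R] Y := { toFun := p, map_add' := p.map_add, map_smul' := fun r x => p.map_smul (σ r) x }
  let f' : Q →ₗ[R] Y := { toFun := f, map_add' := f.map_add, map_smul' := fun r x => f.map_smulₛₗ r x }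
  obtain ⟨g, hg⟩ := Module.projective_lifting_property p' f' hp
  exact ⟨{ toFun := g, map_add' := g.map_add, map_smul' := fun r x => g.map_smul r x },
    fun x => LinearMap.congr_fun hg x⟩

theorem dual_basis {A : Type} [Ring A] (P : Type) [AddCommGroup P] [Module Aᵐᵒᵖ P]
    [Module.Finite Aᵐᵒᵖ P] [Module.Projective Aᵐᵒᵖ P] :
    ∃ (n : ℕ) (x : Fin n → P) (f : Fin n → (P →ₗ[Aᵐᵒᵖ] A)),
      ∀ p, p = ∑ i, op (f i p) • x i := by
  obtain ⟨n, f, g, -, -, h⟩ := Module.Finite.exists_comp_eq_id_of_projective Aᵐᵒᵖ P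
  refine ⟨n, fun i => f (Pi.single i 1), fun i =>
    { toFun := fun p => unop (g p i), map_add' := by simp, map_smul' := by simp }, fun p => ?_⟩
  have := LinearMap.congr_fun h p
  simp only [LinearMap.comp_apply, LinearMap.id_apply] at this
  conv_lhs => rw [← this]
  have h2 : g p = ∑ i, g p i • (Pi.single i 1 : Fin n → Aᵐᵒᵖ) := by
    ext j; simp [Finset.sum_apply, Pi.single_apply]
  conv_lhs => rw [h2]
  simp

theorem expand {A : Type} [Ring A] {P N : Type} [AddCommGroup P] [Module Aᵐᵒᵖ P]
    [AddCommGroup N] [Module Aᵐᵒᵖ N] {n : ℕ} {x : Fin n → P} {f : Fin n → (P →ₗ[Aᵐᵒᵖ] A)}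
    (h : ∀ p, p = ∑ i, op (f i p) • x i) (u : P →ₗ[Aᵐᵒᵖ] N) (p : P) :
    u p = ∑ i, op (f i p) • u (x i) := by
  conv_lhs => rw [h p]
  simp

theorem finite_dual {A : Type} [Ring A] (P : Type) [AddCommGroup P] [Module Aᵐᵒᵖ P]
    [Module.Finite Aᵐᵒᵖ P] [Module.Projective Aᵐᵒᵖ P] : Module.Finite A (P →ₗ[Aᵐᵒᵖ] A) := by
  obtain ⟨n, x, f, h⟩ := dual_basis (A := A) P
  refine Module.Finite.of_surjective (Fintype.linearCombination A f) fun u => ?_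
  refine ⟨fun i => u (x i), ?_⟩
  ext p
  rw [expand h u p]
  simp [Fintype.linearCombination_apply]

/-- superfluous covers of finite modules are finite -/
theorem finite_of_cover {R S : Type} [Ring R] [Ring S] {σ : R →+* S} [RingHomSurjective σ]
    {P M : Type} [AddCommGroup P] [Module R P]
    [AddCommGroup M] [Module S M] (f : P →ₛₗ[σ] M) (N : Submodule S M) (hN : N.FG)
    (hf : LinearMap.range f = N)
    (hs : ∀ N : Submodule R P, N ⊔ LinearMap.ker f = ⊤ → N = ⊤) : Module.Finite R P := by
  classical
  obtain ⟨s, hsN⟩ := hN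
  have : ∀ m ∈ s, ∃ p, f p = m := fun m hm => by
    have : m ∈ LinearMap.range f := by rw [hf, ← hsN]; exact Submodule.subset_span hm
    exact this
  choose! g hg using this
  refine ⟨⟨s.image g, hs _ ?_⟩⟩
  rw [eq_top_iff]
  intro p _
  have h1 : Submodule.map f (Submodule.span R (s.image g : Set P)) = N := by
    rw [Submodule.map_span, ← hsN]
    congr 1
    ext m
    simp only [Finset.coe_image, Set.mem_image, Finset.mem_coe]
    constructor
    · rintro ⟨_, ⟨a, ha, rfl⟩, rfl⟩; rwa [hg a ha]
    · intro hm; exact ⟨g m, ⟨m, hm, rfl⟩, hg m hm⟩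
  have h2 : f p ∈ Submodule.map f (Submodule.span R (s.image g : Set P)) := by
    rw [h1, ← hf]; exact ⟨p, rfl⟩
  obtain ⟨y, hy, hyp⟩ := h2
  rw [← sub_add_cancel p y, add_comm]
  exact Submodule.add_mem_sup hy (by simp [hyp])

/-- vanishing of the tensor product `N ⊗_A U` -/
def TensZero (A : Type) [Ring A] (N U : Type) [AddCommGroup N] [AddCommGroup U]
    [Module Aᵐᵒᵖ N] [Module A U] : Prop :=
  ∀ (Y : Type) [AddCommGroup Y] (ψ : N →+ U →+ Y),
    (∀ (c : A) n u, ψ (op c • n) u = ψ n (c • u)) → ∀ n u, ψ n u = 0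

/-- `N ⊗ coker(P1* → P2*)` is `coker (Hom(P1,N) → Hom(P2,N))`. -/
theorem tensZero_iff {A : Type} [Ring A] {P1 P2 N U : Type} [AddCommGroup P1] [AddCommGroup P2]
    [AddCommGroup N] [AddCommGroup U] [Module Aᵐᵒᵖ P1] [Module Aᵐᵒᵖ P2]
    [Module Aᵐᵒᵖ N] [Module A U] [Module.Finite Aᵐᵒᵖ P1] [Module.Projective Aᵐᵒᵖ P1]
    [Module.Finite Aᵐᵒᵖ P2] [Module.Projective Aᵐᵒᵖ P2]
    (d : P2 →ₗ[Aᵐᵒᵖ] P1) (q : (P2 →ₗ[Aᵐᵒᵖ] A) →ₗ[A] U) (hq : Function.Surjective q)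
    (hk : ∀ g : P2 →ₗ[Aᵐᵒᵖ] A, q g = 0 ↔ ∃ f : P1 →ₗ[Aᵐᵒᵖ] A, g = f.comp d) :
    TensZero A N U ↔ ∀ g : P2 →ₗ[Aᵐᵒᵖ] N, ∃ f : P1 →ₗ[Aᵐᵒᵖ] N, g = f.comp d := by
  obtain ⟨n2, x2, f2, h2⟩ := dual_basis (A := A) P2
  obtain ⟨n1, x1, f1, h1⟩ := dual_basis (A := A) P1
  -- the map `n, g ↦ n·g`
  let act {P : Type} [AddCommGroup P] [Module Aᵐᵒᵖ P] (n : N) (g : P →ₗ[Aᵐᵒᵖ] A) : P →ₗ[Aᵐᵒᵖ] N :=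
    { toFun := fun p => op (g p) • n
      map_add' := by intro x y; simp [add_smul]
      map_smul' := by intro c x; simp [mul_smul] }
  constructor
  · intro hT
    let J : AddSubgroup (P2 →ₗ[Aᵐᵒᵖ] N) :=
      { carrier := {g | ∃ f : P1 →ₗ[Aᵐᵒᵖ] N, g = f.comp d}
        zero_mem' := ⟨0, by simp⟩
        add_mem' := by
          rintro _ _ ⟨f, rfl⟩ ⟨g, rfl⟩
          exact ⟨f + g, by rw [LinearMap.add_comp]⟩
        neg_mem' := by
          rintro _ ⟨f, rfl⟩
          exact ⟨-f, by rw [LinearMap.neg_comp]⟩ }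
    let s := Function.surjInv hq
    have hs : ∀ u, q (s u) = u := Function.surjInv_eq hq
    have key : ∀ (n : N) (g g' : P2 →ₗ[Aᵐᵒᵖ] A), q g = q g' →
        (QuotientAddGroup.mk (act n g) : _ ⧸ J) = QuotientAddGroup.mk (act n g') := by
      intro n g g' hg
      rw [QuotientAddGroup.eq]
      obtain ⟨f, hf⟩ := (hk (-g + g')).1 (by simp [hg])
      refine ⟨act n f, ?_⟩
      ext p
      have := LinearMap.congr_fun hf p
      simp only [LinearMap.add_apply, LinearMap.neg_apply, LinearMap.comp_apply] at this
      simp only [LinearMap.add_apply, LinearMap.neg_apply, LinearMap.comp_apply, act,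
        LinearMap.coe_mk, AddHom.coe_mk, ← this]
      simp [add_smul]
    let ψ : N →+ U →+ (_ ⧸ J) := AddMonoidHom.mk' (fun n => AddMonoidHom.mk'
        (fun u => (QuotientAddGroup.mk (act n (s u)) : _ ⧸ J)) (by
          intro a b
          rw [key n (s (a + b)) (s a + s b) (by simp [hs]), ← QuotientAddGroup.mk_add]
          congr 1
          ext p
          simp [act, add_smul])) (by
          intro a b
          ext u
          simp only [AddMonoidHom.mk'_apply, AddMonoidHom.add_apply]
          rw [← QuotientAddGroup.mk_add]
          congr 1
          ext p
          simp [act])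
    have hψ := hT _ ψ (by
      intro c n u
      change (QuotientAddGroup.mk (act (op c • n) (s u)) : _ ⧸ J) =
        QuotientAddGroup.mk (act n (s (c • u)))
      rw [key n (s (c • u)) (c • s u) (by simp [hs])]
      congr 1
      ext p
      simp [act, mul_smul])
    have hJ : ∀ n g, act n g ∈ J := fun n g => by
      have := hψ n (q g)
      change (QuotientAddGroup.mk (act n (s (q g))) : _ ⧸ J) = 0 at this
      rw [key n (s (q g)) g (by simp [hs])] at this
      exact (QuotientAddGroup.eq_zero_iff _).1 this
    intro g
    have : g = ∑ i, act (g (x2 i)) (f2 i) := by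
      ext p
      rw [expand h2 g p]
      simp [act]
    change g ∈ J
    rw [this]
    exact AddSubgroup.sum_mem _ fun i _ => hJ _ _
  · intro hV Y _ ψ hψ n u
    obtain ⟨g, rfl⟩ := hq u
    have h3 : ∀ (n : N) (g : P2 →ₗ[Aᵐᵒᵖ] A), ∑ i, ψ (act n g (x2 i)) (q (f2 i)) = ψ n (q g) := by
      intro n g
      have : g = ∑ i, g (x2 i) • f2 i := by
        ext p
        rw [expand h2 g p]
        simp
      conv_rhs => rw [this]
      simp [act, hψ]
    obtain ⟨f, hf⟩ := hV (act n g)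
    rw [← h3, hf]
    have h4 : ∀ p, f p = ∑ j, op (f1 j p) • f (x1 j) := expand h1 f
    have h5 : f.comp d = ∑ j, act (f (x1 j)) ((f1 j).comp d) := by
      ext p
      simp only [LinearMap.comp_apply]
      rw [h4]
      simp [act]
    rw [h5]
    simp only [LinearMap.sum_apply, map_sum, AddMonoidHom.finsetSum_apply]
    rw [Finset.sum_comm]
    refine Finset.sum_eq_zero fun j _ => ?_
    rw [h3, (hk _).2 ⟨_, rfl⟩, map_zero]

end RelExtProof

open CategoryTheory MulOpposite

namespace RelExtProof

section AZ

variable (C : Type) [Ring C] (E : Type) [AddCommGroup E] [Module C E] [Module Cᵐᵒᵖ E]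
  [SMulCommClass C Cᵐᵒᵖ E]

abbrev piO : (TrivSqZeroExt C E)ᵐᵒᵖ →+* Cᵐᵒᵖ := RingHom.op (tszeFst C E)
abbrev ioO : Cᵐᵒᵖ →+* (TrivSqZeroExt C E)ᵐᵒᵖ := RingHom.op (tszeInl C E)

instance : RingHomSurjective (piO C E) :=
  ⟨fun c => ⟨op (TrivSqZeroExt.inl (unop c)), rfl⟩⟩

variable {C E}

/-- the subgroup `K·E` -/
def mE {Q : Type} [AddCommGroup Q] [Module (TrivSqZeroExt C E)ᵐᵒᵖ Q]
    (K : Submodule (TrivSqZeroExt C E)ᵐᵒᵖ Q) : AddSubgroup Q :=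
  AddSubgroup.closure {y | ∃ x ∈ K, ∃ e : E, y = op (TrivSqZeroExt.inr e : TrivSqZeroExt C E) • x}

theorem mem_mE {Q : Type} [AddCommGroup Q] [Module (TrivSqZeroExt C E)ᵐᵒᵖ Q]
    {K : Submodule (TrivSqZeroExt C E)ᵐᵒᵖ Q} {x : Q} (hx : x ∈ K) (e : E) :
    op (TrivSqZeroExt.inr e : TrivSqZeroExt C E) • x ∈ mE K :=
  AddSubgroup.subset_closure ⟨x, hx, e, rfl⟩

theorem mE_smul {Q : Type} [AddCommGroup Q] [Module (TrivSqZeroExt C E)ᵐᵒᵖ Q]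
    {K : Submodule (TrivSqZeroExt C E)ᵐᵒᵖ Q} (b : TrivSqZeroExt C E) {z : Q} (hz : z ∈ mE K) :
    op b • z ∈ mE K := by
  induction hz using AddSubgroup.closure_induction with
  | mem z hz =>
    obtain ⟨x, hx, e, rfl⟩ := hz
    rw [← mul_smul, ← op_mul]
    have : (TrivSqZeroExt.inr e : TrivSqZeroExt C E) * b = TrivSqZeroExt.inr (op b.fst • e) := by
      ext <;> simp
    rw [this]
    exact mem_mE hx _
  | zero => simp
  | add x y _ _ hx hy => rw [smul_add]; exact add_mem hx hy
  | neg x _ hx => rw [smul_neg]; exact neg_mem hx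

theorem semilin_mE {Q X : Type} [AddCommGroup Q] [Module (TrivSqZeroExt C E)ᵐᵒᵖ Q]
    [AddCommGroup X] [Module Cᵐᵒᵖ X]
    {K : Submodule (TrivSqZeroExt C E)ᵐᵒᵖ Q} (h : Q →ₛₗ[piO C E] X) {z : Q} (hz : z ∈ mE K) :
    h z = 0 := by
  induction hz using AddSubgroup.closure_induction with
  | mem z hz =>
    obtain ⟨x, hx, e, rfl⟩ := hz
    rw [h.map_smulₛₗ]
    have : piO C E (op (TrivSqZeroExt.inr e)) = 0 := rfl
    rw [this, zero_smul]
  | zero => simp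
  | add x y _ _ hx hy => simp [hx, hy]
  | neg x _ hx => simp [hx]

/-- the submodule `s(P) + Q E` -/
def secSub {P Q : Type} [AddCommGroup Q] [Module (TrivSqZeroExt C E)ᵐᵒᵖ Q]
    [AddCommGroup P] [Module Cᵐᵒᵖ P] (s : P →ₛₗ[ioO C E] Q) :
    Submodule (TrivSqZeroExt C E)ᵐᵒᵖ Q where
  carrier := {y | ∃ p, ∃ z ∈ mE (⊤ : Submodule (TrivSqZeroExt C E)ᵐᵒᵖ Q), y = s p + z}
  zero_mem' := ⟨0, 0, zero_mem _, by simp⟩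
  add_mem' := by
    rintro _ _ ⟨p, z, hz, rfl⟩ ⟨p', z', hz', rfl⟩
    exact ⟨p + p', z + z', add_mem hz hz', by rw [map_add]; abel⟩
  smul_mem' := by
    rintro b _ ⟨p, z, hz, rfl⟩
    refine ⟨op (unop b).fst • p, op (TrivSqZeroExt.inr (unop b).snd : TrivSqZeroExt C E) • s p + b • z,
      add_mem (mem_mE Submodule.mem_top _) (mE_smul (unop b) hz), ?_⟩
    rw [s.map_smulₛₗ, smul_add, ← add_assoc, ← add_smul]
    congr 2
    apply unop_injective
    exact (TrivSqZeroExt.inl_fst_add_inr_snd_eq (unop b)).symm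

theorem mE_map {Q1 Q0 : Type} [AddCommGroup Q1] [Module (TrivSqZeroExt C E)ᵐᵒᵖ Q1]
    [AddCommGroup Q0] [Module (TrivSqZeroExt C E)ᵐᵒᵖ Q0]
    (f : Q1 →ₗ[(TrivSqZeroExt C E)ᵐᵒᵖ] Q0) {K : Submodule (TrivSqZeroExt C E)ᵐᵒᵖ Q0}
    (hK : LinearMap.range f = K) (z : Q0) :
    z ∈ mE K ↔ ∃ y ∈ mE (⊤ : Submodule (TrivSqZeroExt C E)ᵐᵒᵖ Q1), f y = z := by
  constructor
  · intro hz
    induction hz using AddSubgroup.closure_induction with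
    | mem z hz =>
      obtain ⟨x, hx, e, rfl⟩ := hz
      rw [← hK] at hx
      obtain ⟨y, rfl⟩ := hx
      exact ⟨_, mem_mE Submodule.mem_top e, by rw [map_smul]⟩
    | zero => exact ⟨0, zero_mem _, by simp⟩
    | add x y _ _ hx hy =>
      obtain ⟨a, ha, rfl⟩ := hx
      obtain ⟨b, hb, rfl⟩ := hy
      exact ⟨a + b, add_mem ha hb, by simp⟩
    | neg x _ hx =>
      obtain ⟨a, ha, rfl⟩ := hx
      exact ⟨-a, neg_mem ha, by simp⟩
  · rintro ⟨y, hy, rfl⟩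
    induction hy using AddSubgroup.closure_induction with
    | mem z hz =>
      obtain ⟨x, hx, e, rfl⟩ := hz
      rw [map_smul]
      exact mem_mE (by rw [← hK]; exact ⟨x, rfl⟩) e
    | zero => simp
    | add x y _ _ hx hy => simpa using add_mem hx hy
    | neg x _ hx => simpa using hx

variable {M P1 P0 Q1 Q0 : Type} [AddCommGroup M] [AddCommGroup P1] [AddCommGroup P0]
  [AddCommGroup Q1] [AddCommGroup Q0] [Module Cᵐᵒᵖ M] [Module Cᵐᵒᵖ P1] [Module Cᵐᵒᵖ P0]
  [Module (TrivSqZeroExt C E)ᵐᵒᵖ Q1] [Module (TrivSqZeroExt C E)ᵐᵒᵖ Q0]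
  {d1 : P1 →ₗ[Cᵐᵒᵖ] P0} {d0 : P0 →ₗ[Cᵐᵒᵖ] M}
  {D1 : Q1 →ₗ[(TrivSqZeroExt C E)ᵐᵒᵖ] Q0} {D0 : Q0 →ₛₗ[piO C E] M}

/-- comparison of the two minimal presentations -/
structure Cmp (d1 : P1 →ₗ[Cᵐᵒᵖ] P0) (d0 : P0 →ₗ[Cᵐᵒᵖ] M)
  (D1 : Q1 →ₗ[(TrivSqZeroExt C E)ᵐᵒᵖ] Q0) (D0 : Q0 →ₛₗ[piO C E] M) where
  h0 : Q0 →ₛₗ[piO C E] P0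
  h1 : Q1 →ₛₗ[piO C E] P1
  s0 : P0 →ₛₗ[ioO C E] Q0
  s1 : P1 →ₛₗ[ioO C E] Q1
  w : P1 ≃ₗ[Cᵐᵒᵖ] P1
  dh0 : ∀ x, d0 (h0 x) = D0 x
  dh1 : ∀ x, d1 (h1 x) = h0 (D1 x)
  hs0 : ∀ p, h0 (s0 p) = p
  hs1 : ∀ p, h1 (s1 p) = w p
  ds : ∀ p, D1 (s1 p) = s0 (d1 p)
  kerh0 : ∀ x, h0 x = 0 → x ∈ mE (⊤ : Submodule (TrivSqZeroExt C E)ᵐᵒᵖ Q0)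
  exd : ∀ x, d0 x = 0 ↔ ∃ y, d1 y = x
  exD : ∀ x, D0 x = 0 ↔ ∃ y, D1 y = x
  surjd : Function.Surjective d0
  surjD : Function.Surjective D0

theorem exists_cmp [Module.Projective Cᵐᵒᵖ P1] [Module.Projective Cᵐᵒᵖ P0]
    [Module.Projective (TrivSqZeroExt C E)ᵐᵒᵖ Q1] [Module.Projective (TrivSqZeroExt C E)ᵐᵒᵖ Q0]
    [IsNoetherian Cᵐᵒᵖ P1]
    (surjd : Function.Surjective d0) (surjD : Function.Surjective D0)
    (exd : LinearMap.range d1 = LinearMap.ker d0) (exD : LinearMap.range D1 = LinearMap.ker D0)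
    (md0 : ∀ N : Submodule _ P0, N ⊔ LinearMap.ker d0 = ⊤ → N = ⊤)
    (md1 : ∀ N : Submodule _ P1, N ⊔ LinearMap.ker d1 = ⊤ → N = ⊤)
    (mD0 : ∀ N : Submodule _ Q0, N ⊔ LinearMap.ker D0 = ⊤ → N = ⊤) :
    Nonempty (Cmp d1 d0 D1 D0) := by
  have exd' : ∀ x, d0 x = 0 ↔ ∃ y, d1 y = x := fun x => by
    rw [← LinearMap.mem_ker, ← exd]; rfl
  have exD' : ∀ x, D0 x = 0 ↔ ∃ y, D1 y = x := fun x => by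
    rw [← LinearMap.mem_ker, ← exD]; rfl
  obtain ⟨h0, dh0⟩ := semilin_lift (piO C E) d0 surjd D0
  have h0surj : LinearMap.range h0 = ⊤ := by
    apply md0
    rw [eq_top_iff]
    intro p _
    obtain ⟨x, hx⟩ := surjD (d0 p)
    rw [← add_sub_cancel (h0 x) p]
    exact Submodule.add_mem_sup ⟨x, rfl⟩ (by simp [dh0, hx])
  -- the section `s0`
  let _ : Module Cᵐᵒᵖ Q0 := Module.compHom Q0 (ioO C E)
  let _ : Module Cᵐᵒᵖ Q1 := Module.compHom Q1 (ioO C E)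
  have hpi : ∀ c : Cᵐᵒᵖ, piO C E (ioO C E c) = c := fun c => rfl
  let h0' : Q0 →ₗ[Cᵐᵒᵖ] P0 :=
    { toFun := h0, map_add' := h0.map_add
      map_smul' := fun c x => by
        change h0 (ioO C E c • x) = _
        rw [h0.map_smulₛₗ, hpi]; rfl }
  obtain ⟨s0', hs0'⟩ := Module.projective_lifting_property h0' LinearMap.id
    (fun p => by
      have : p ∈ LinearMap.range h0 := by rw [h0surj]; trivial
      exact this)
  let s0 : P0 →ₛₗ[ioO C E] Q0 :=
    { toFun := s0', map_add' := s0'.map_add, map_smul' := fun c x => s0'.map_smul c x }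
  have hs0 : ∀ p, h0 (s0 p) = p := fun p => LinearMap.congr_fun hs0' p
  -- kernel of `h0`
  have htop : secSub s0 = ⊤ := by
    apply mD0
    rw [eq_top_iff]
    intro x _
    rw [← add_sub_cancel (s0 (h0 x)) x]
    refine Submodule.add_mem_sup ⟨h0 x, 0, zero_mem _, by simp⟩ ?_
    simp [← dh0, hs0]
  have kerh0 : ∀ x, h0 x = 0 → x ∈ mE (⊤ : Submodule (TrivSqZeroExt C E)ᵐᵒᵖ Q0) := by
    intro x hx
    have : x ∈ secSub s0 := by rw [htop]; trivial
    obtain ⟨p, z, hz, rfl⟩ := this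
    rw [map_add, hs0, semilin_mE h0 hz, add_zero] at hx
    simpa [hx] using hz
  -- `h1`
  let dK : P1 →ₗ[Cᵐᵒᵖ] LinearMap.ker d0 :=
    d1.codRestrict _ (fun p => (exd' _).2 ⟨p, rfl⟩)
  let hK : Q1 →ₛₗ[piO C E] LinearMap.ker d0 :=
    (h0.comp D1).codRestrict _ (fun x => by
      simp only [LinearMap.comp_apply, LinearMap.mem_ker, dh0]
      exact (exD' _).2 ⟨x, rfl⟩)
  obtain ⟨h1, hh1⟩ := semilin_lift (piO C E) dK (by
    rintro ⟨x, hx⟩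
    obtain ⟨y, rfl⟩ := (exd' x).1 hx
    exact ⟨y, rfl⟩) hK
  have dh1 : ∀ x, d1 (h1 x) = h0 (D1 x) := fun x => congrArg Subtype.val (hh1 x)
  -- `s1`
  let D1' : Q1 →ₗ[Cᵐᵒᵖ] Q0 :=
    { toFun := D1, map_add' := D1.map_add, map_smul' := fun c x => D1.map_smul (ioO C E c) x }
  let D1r : Q1 →ₗ[Cᵐᵒᵖ] LinearMap.range D1' := D1'.rangeRestrict
  let t : P1 →ₗ[Cᵐᵒᵖ] LinearMap.range D1' := (s0'.comp d1).codRestrict _ (fun p => by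
    obtain ⟨y, hy⟩ := (exD' (s0 (d1 p))).1 (by
      rw [← dh0, hs0]; exact (exd' _).2 ⟨p, rfl⟩)
    exact ⟨y, hy⟩)
  obtain ⟨s1', hs1'⟩ := Module.projective_lifting_property D1r t
    D1'.surjective_rangeRestrict
  let s1 : P1 →ₛₗ[ioO C E] Q1 :=
    { toFun := s1', map_add' := s1'.map_add, map_smul' := fun c x => s1'.map_smul c x }
  have ds : ∀ p, D1 (s1 p) = s0 (d1 p) := fun p =>
    congrArg Subtype.val (LinearMap.congr_fun hs1' p)
  let w : P1 →ₗ[Cᵐᵒᵖ] P1 :=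
    { toFun := fun p => h1 (s1 p), map_add' := by simp
      map_smul' := fun c x => by rw [s1.map_smulₛₗ, h1.map_smulₛₗ, hpi]; rfl }
  have wsurj : Function.Surjective w := by
    rw [← LinearMap.range_eq_top]
    apply md1
    rw [eq_top_iff]
    intro p _
    rw [← add_sub_cancel (w p) p]
    refine Submodule.add_mem_sup ⟨p, rfl⟩ ?_
    rw [LinearMap.mem_ker, map_sub, sub_eq_zero]
    change d1 p = d1 (h1 (s1 p))
    rw [dh1, ds, hs0]
  have winj := IsNoetherian.injective_of_surjective_endomorphism w wsurj
  exact ⟨⟨h0, h1, s0, s1, LinearEquiv.ofBijective w ⟨winj, wsurj⟩, dh0, dh1, hs0, fun p => rfl, ds,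
    kerh0, exd', exD', surjd, surjD⟩⟩

/-- `M ⊗ E = 0` in terms of the cover `Q0 → M`. -/
theorem tens_iff [Module.Finite (TrivSqZeroExt C E)ᵐᵒᵖ Q0]
    [Module.Projective (TrivSqZeroExt C E)ᵐᵒᵖ Q0] (hD : Function.Surjective D0) :
    TensZero C M E ↔ mE (⊤ : Submodule (TrivSqZeroExt C E)ᵐᵒᵖ Q0) ≤ mE (LinearMap.ker D0) := by
  constructor
  · intro hT
    let s := Function.surjInv hD
    have hs : ∀ m, D0 (s m) = m := Function.surjInv_eq hD
    have key : ∀ (e : E) (x y : Q0), D0 x = D0 y →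
        (QuotientAddGroup.mk (op (TrivSqZeroExt.inr e : TrivSqZeroExt C E) • x) :
          _ ⧸ mE (LinearMap.ker D0)) =
        QuotientAddGroup.mk (op (TrivSqZeroExt.inr e : TrivSqZeroExt C E) • y) := by
      intro e x y hxy
      rw [QuotientAddGroup.eq, ← smul_neg, ← smul_add]
      exact mem_mE (by simp [hxy]) e
    let ψ : M →+ E →+ (_ ⧸ mE (LinearMap.ker D0)) := AddMonoidHom.mk' (fun m => AddMonoidHom.mk'
        (fun e => (QuotientAddGroup.mk (op (TrivSqZeroExt.inr e : TrivSqZeroExt C E) • s m) :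
          _ ⧸ mE (LinearMap.ker D0))) (by
          intro a b
          rw [← QuotientAddGroup.mk_add, ← add_smul]
          simp)) (by
          intro a b
          ext e
          simp only [AddMonoidHom.mk'_apply, AddMonoidHom.add_apply]
          rw [← QuotientAddGroup.mk_add, ← smul_add]
          exact key _ _ _ (by simp [hs]))
    have hψ := hT _ ψ (by
      intro c m e
      change (QuotientAddGroup.mk (op (TrivSqZeroExt.inr e : TrivSqZeroExt C E) • s (op c • m)) :
          _ ⧸ mE (LinearMap.ker D0)) =
        QuotientAddGroup.mk (op (TrivSqZeroExt.inr (c • e) : TrivSqZeroExt C E) • s m)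
      rw [key e (s (op c • m)) (op (TrivSqZeroExt.inl c : TrivSqZeroExt C E) • s m)]
      · rw [← mul_smul, ← op_mul, TrivSqZeroExt.inl_mul_inr]
      · rw [hs, D0.map_smulₛₗ, hs]; rfl)
    unfold mE
    rw [AddSubgroup.closure_le]
    rintro _ ⟨x, -, e, rfl⟩
    have := hψ (D0 x) e
    change (QuotientAddGroup.mk (op (TrivSqZeroExt.inr e : TrivSqZeroExt C E) • s (D0 x)) :
          _ ⧸ mE (LinearMap.ker D0)) = 0 at this
    rw [key e (s (D0 x)) x (hs _)] at this
    exact (QuotientAddGroup.eq_zero_iff _).1 this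
  · intro hK Y _ ψ hψ m e
    obtain ⟨n, x, f, h⟩ := dual_basis (A := TrivSqZeroExt C E) Q0
    let Ψ : Q0 →+ Y := ∑ i, (ψ (D0 (x i))).comp
      (AddMonoidHom.mk' (fun y => (f i y).snd) (by simp))
    have hΨ : ∀ y e, Ψ (op (TrivSqZeroExt.inr e : TrivSqZeroExt C E) • y) = ψ (D0 y) e := by
      intro y e
      have h2 : D0 y = ∑ i, op (f i y).fst • D0 (x i) := by
        conv_lhs => rw [h y]
        rw [map_sum]
        refine Finset.sum_congr rfl fun i _ => ?_
        rw [D0.map_smulₛₗ]; rfl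
      rw [h2]
      simp only [Ψ, AddMonoidHom.finsetSum_apply, AddMonoidHom.comp_apply,
        AddMonoidHom.mk'_apply, map_sum, hψ]
      refine Finset.sum_congr rfl fun i _ => ?_
      congr 1
      rw [map_smul]
      simp
    obtain ⟨y, rfl⟩ := hD m
    rw [← hΨ]
    have h3 : ∀ z ∈ mE (LinearMap.ker D0), Ψ z = 0 := by
      intro z hz
      induction hz using AddSubgroup.closure_induction with
      | mem z hz =>
        obtain ⟨x, hx, e, rfl⟩ := hz
        rw [hΨ, LinearMap.mem_ker.1 hx]; simp
      | zero => simp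
      | add x y _ _ hx hy => simp [hx, hy]
      | neg x _ hx => simp [hx]
    exact h3 _ (hK (mem_mE Submodule.mem_top e))

end AZ
end RelExtProof

open CategoryTheory MulOpposite

namespace RelExtProof

section LA
variable {k : Type} [Field k]

theorem pairing_finrank {X N : Type} [AddCommGroup X] [AddCommGroup N] [Module k X] [Module k N]
    [FiniteDimensional k X] (φ : N → X → k)
    (h1 : ∀ n n' m, φ (n + n') m = φ n m + φ n' m)
    (h2 : ∀ n m m', φ n (m + m') = φ n m + φ n m')
    (h3 : ∀ (c : k) n m, φ n (c • m) = c * φ n m)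
    (h4 : ∀ (c : k) n m, φ (c • n) m = c * φ n m)
    (h5 : ∀ n, (∀ m, φ n m = 0) → n = 0) :
    FiniteDimensional k N ∧ Module.finrank k N ≤ Module.finrank k X := by
  let Φ : N →ₗ[k] Module.Dual k X := LinearMap.mk₂ k φ h1 h4 h2 h3
  have hi : Function.Injective Φ := by
    rw [injective_iff_map_eq_zero]
    intro n hn
    exact h5 n fun m => LinearMap.congr_fun hn m
  refine ⟨Module.Finite.of_injective Φ hi, ?_⟩
  have := LinearMap.finrank_le_finrank_of_injective hi
  rwa [Subspace.dual_finrank_eq] at this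

theorem pairing_surj {X N : Type} [AddCommGroup X] [AddCommGroup N] [Module k X] [Module k N]
    [FiniteDimensional k X] (φ : N → X → k)
    (h1 : ∀ n n' m, φ (n + n') m = φ n m + φ n' m)
    (h2 : ∀ n m m', φ n (m + m') = φ n m + φ n m')
    (h3 : ∀ (c : k) n m, φ n (c • m) = c * φ n m)
    (h4 : ∀ (c : k) n m, φ (c • n) m = c * φ n m)
    (h6 : ∀ m, (∀ n, φ n m = 0) → m = 0) (f : X →ₗ[k] k) : ∃ n, ∀ m, φ n m = f m := by
  let Φ : N →ₗ[k] Module.Dual k X := LinearMap.mk₂ k φ h1 h4 h2 h3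
  have : LinearMap.range Φ = ⊤ := by
    rw [← Subspace.dualCoannihilator_dualAnnihilator_eq (W := LinearMap.range Φ)]
    have : (LinearMap.range Φ).dualCoannihilator = ⊥ := by
      rw [eq_bot_iff]
      intro x hx
      rw [Submodule.mem_dualCoannihilator] at hx
      exact h6 x fun n => hx _ ⟨n, rfl⟩
    rw [this, Submodule.dualAnnihilator_bot]
  have hf : f ∈ LinearMap.range Φ := by rw [this]; trivial
  obtain ⟨n, hn⟩ := hf
  exact ⟨n, fun m => LinearMap.congr_fun hn m⟩

theorem surj_of_dims {X Y H T1 T2 : Type} [AddCommGroup X] [AddCommGroup Y] [AddCommGroup H]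
    [AddCommGroup T1] [AddCommGroup T2] [Module k X] [Module k Y] [Module k H] [Module k T1]
    [Module k T2] [FiniteDimensional k X] [FiniteDimensional k Y]
    (qX : X →ₗ[k] T1) (hqX : Function.Surjective qX) (qY : Y →ₗ[k] T2)
    (hqY : Function.Surjective qY) (α : X →ₗ[k] H) (hα : Function.Surjective α)
    (β : Y →ₗ[k] H) (hβ : Function.Injective β)
    (h : ∀ x, qX x = 0 → ∃ y, qY y = 0 ∧ β y = α x)
    (hd : Module.finrank k T1 ≤ Module.finrank k T2) : Function.Surjective β := by
  have : FiniteDimensional k H := Module.Finite.of_surjective α hα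
  have : FiniteDimensional k T1 := Module.Finite.of_surjective qX hqX
  let J := Submodule.map β (LinearMap.ker qY)
  let r : X →ₗ[k] H ⧸ J := J.mkQ.comp α
  have hr : LinearMap.ker qX ≤ LinearMap.ker r := by
    intro x hx
    obtain ⟨y, hy, hxy⟩ := h x hx
    simp only [r, LinearMap.mem_ker, LinearMap.comp_apply, Submodule.mkQ_apply,
      Submodule.Quotient.mk_eq_zero]
    exact ⟨y, hy, hxy⟩
  have h1 : Module.finrank k (H ⧸ J) ≤ Module.finrank k T1 := by
    rw [← (qX.quotKerEquivOfSurjective hqX).finrank_eq]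
    refine LinearMap.finrank_le_finrank_of_surjective (f := (LinearMap.ker qX).liftQ r hr) ?_
    rw [← LinearMap.range_eq_top, Submodule.range_liftQ, LinearMap.range_eq_top]
    exact (Submodule.mkQ_surjective J).comp hα
  have h2 := Submodule.finrank_quotient_add_finrank J
  have h3 : Module.finrank k J = Module.finrank k (LinearMap.ker qY) :=
    (LinearEquiv.finrank_eq (Submodule.equivMapOfInjective β hβ _)).symm
  have h4 := LinearMap.finrank_range_add_finrank_ker qY
  rw [LinearMap.range_eq_top.2 hqY, finrank_top] at h4
  have h5 : Module.finrank k Y = Module.finrank k H :=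
    le_antisymm (LinearMap.finrank_le_finrank_of_injective hβ) (by omega)
  exact (LinearMap.injective_iff_surjective_of_finrank_eq_finrank h5).1 hβ

end LA

section AZ

variable {C : Type} [Ring C] {E : Type} [AddCommGroup E] [Module C E] [Module Cᵐᵒᵖ E]
  [SMulCommClass C Cᵐᵒᵖ E]
variable {M P1 P0 Q1 Q0 : Type} [AddCommGroup M] [AddCommGroup P1] [AddCommGroup P0]
  [AddCommGroup Q1] [AddCommGroup Q0] [Module Cᵐᵒᵖ M] [Module Cᵐᵒᵖ P1] [Module Cᵐᵒᵖ P0]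
  [Module (TrivSqZeroExt C E)ᵐᵒᵖ Q1] [Module (TrivSqZeroExt C E)ᵐᵒᵖ Q0]
  {d1 : P1 →ₗ[Cᵐᵒᵖ] P0} {d0 : P0 →ₗ[Cᵐᵒᵖ] M}
  {D1 : Q1 →ₗ[(TrivSqZeroExt C E)ᵐᵒᵖ] Q0} {D0 : Q0 →ₛₗ[piO C E] M}

theorem Cmp.h1surj (c : Cmp d1 d0 D1 D0) (p : P1) : ∃ x, c.h1 x = p :=
  ⟨c.s1 (c.w.symm p), by rw [c.hs1]; simp⟩

theorem Cmp.rangeD (c : Cmp d1 d0 D1 D0) : LinearMap.range D1 = LinearMap.ker D0 := by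
  ext x
  rw [LinearMap.mem_ker, c.exD]; rfl

theorem descend {Q P X : Type} [AddCommGroup Q] [AddCommGroup P] [AddCommGroup X]
    [Module (TrivSqZeroExt C E)ᵐᵒᵖ Q] [Module Cᵐᵒᵖ P] [Module Cᵐᵒᵖ X]
    (h : Q →ₛₗ[piO C E] P) (hs : ∀ p, ∃ x, h x = p)
    (hk : ∀ x, h x = 0 → x ∈ mE (⊤ : Submodule (TrivSqZeroExt C E)ᵐᵒᵖ Q))
    (v : Q →ₛₗ[piO C E] X) : ∃ g : P →ₗ[Cᵐᵒᵖ] X, ∀ x, g (h x) = v x := by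
  choose r hr using hs
  have key : ∀ x y, h x = h y → v x = v y := fun x y hxy => by
    have := semilin_mE v (hk (x - y) (by simp [hxy]))
    rwa [map_sub, sub_eq_zero] at this
  refine ⟨{ toFun := fun p => v (r p), map_add' := fun a b => ?_, map_smul' := fun c a => ?_ },
    fun x => key _ _ (hr _)⟩
  · rw [← map_add]; exact key _ _ (by simp [hr])
  · have : v (ioO C E c • r a) = c • v (r a) := by rw [v.map_smulₛₗ]; rfl
    rw [RingHom.id_apply, ← this]
    apply key
    rw [h.map_smulₛₗ, hr, hr]; rfl

theorem Cmp.kerh1_tens (c : Cmp d1 d0 D1 D0)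
    (hk : ∀ x, c.h1 x = 0 → x ∈ mE (⊤ : Submodule (TrivSqZeroExt C E)ᵐᵒᵖ Q1)) :
    mE (⊤ : Submodule (TrivSqZeroExt C E)ᵐᵒᵖ Q0) ≤ mE (LinearMap.ker D0) := by
  intro x hx
  obtain ⟨y, rfl⟩ := (c.exD x).1 (semilin_mE D0 hx)
  let p := c.w.symm (c.h1 y)
  have hz : y - c.s1 p ∈ mE (⊤ : Submodule (TrivSqZeroExt C E)ᵐᵒᵖ Q1) :=
    hk _ (by rw [map_sub, c.hs1]; simp [p])
  have hp : d1 p = 0 := by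
    have h1 : c.h0 (D1 (y - c.s1 p)) = 0 := by
      rw [← c.dh1, semilin_mE c.h1 hz, map_zero]
    rw [map_sub, map_sub, semilin_mE c.h0 hx, c.ds, c.hs0] at h1
    simpa using h1
  refine (mE_map D1 c.rangeD _).2 ⟨_, hz, ?_⟩
  rw [map_sub, c.ds, hp]; simp

theorem Cmp.tens_kerh1 (c : Cmp d1 d0 D1 D0)
    (mD1 : ∀ N : Submodule _ Q1, N ⊔ LinearMap.ker D1 = ⊤ → N = ⊤)
    (hT : mE (⊤ : Submodule (TrivSqZeroExt C E)ᵐᵒᵖ Q0) ≤ mE (LinearMap.ker D0)) :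
    ∀ x, c.h1 x = 0 → x ∈ mE (⊤ : Submodule (TrivSqZeroExt C E)ᵐᵒᵖ Q1) := by
  have htop : secSub c.s1 = ⊤ := by
    apply mD1
    rw [eq_top_iff]
    intro y _
    let p := c.w.symm (c.h1 y)
    have h1 : c.h1 (y - c.s1 p) = 0 := by rw [map_sub, c.hs1]; simp [p]
    have h2 : D1 (y - c.s1 p) ∈ mE (LinearMap.ker D0) :=
      hT (c.kerh0 _ (by rw [← c.dh1, h1, map_zero]))
    obtain ⟨z, hz, hzy⟩ := (mE_map D1 c.rangeD _).1 h2
    have : y = (c.s1 p + z) + (y - c.s1 p - z) := by abel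
    rw [this]
    refine Submodule.add_mem_sup ⟨p, z, hz, rfl⟩ ?_
    rw [LinearMap.mem_ker, map_sub, hzy, sub_self]
  intro x hx
  have : x ∈ secSub c.s1 := by rw [htop]; trivial
  obtain ⟨p, z, hz, rfl⟩ := this
  rw [map_add, c.hs1, semilin_mE c.h1 hz, add_zero] at hx
  have : p = 0 := by simpa using hx
  simpa [this] using hz

/-- the `E`-part of the inclusion as a semilinear-to-linear construction -/
def inrLift {Q : Type} [AddCommGroup Q] [Module (TrivSqZeroExt C E)ᵐᵒᵖ Q]
    (g : Q →ₛₗ[piO C E] E) : Q →ₗ[(TrivSqZeroExt C E)ᵐᵒᵖ] TrivSqZeroExt C E where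
  toFun x := TrivSqZeroExt.inr (g x)
  map_add' x y := by simp
  map_smul' b x := by
    rw [g.map_smulₛₗ]
    ext <;> simp
    rfl

def fstPart {Q : Type} [AddCommGroup Q] [Module (TrivSqZeroExt C E)ᵐᵒᵖ Q]
    (g : Q →ₗ[(TrivSqZeroExt C E)ᵐᵒᵖ] TrivSqZeroExt C E) : Q →ₛₗ[piO C E] C where
  toFun x := (g x).fst
  map_add' x y := by simp
  map_smul' b x := by
    rw [map_smul]
    simp
    rfl

theorem exists_fstPart {Q : Type} [AddCommGroup Q] [Module (TrivSqZeroExt C E)ᵐᵒᵖ Q]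
    [Module.Projective (TrivSqZeroExt C E)ᵐᵒᵖ Q]
    (v : Q →ₛₗ[piO C E] C) : ∃ u : Q →ₗ[(TrivSqZeroExt C E)ᵐᵒᵖ] TrivSqZeroExt C E,
      fstPart u = v := by
  let _ : Module (TrivSqZeroExt C E)ᵐᵒᵖ C := Module.compHom C (piO C E)
  let p' : TrivSqZeroExt C E →ₗ[(TrivSqZeroExt C E)ᵐᵒᵖ] C :=
    { toFun := TrivSqZeroExt.fst, map_add' := fun _ _ => rfl
      map_smul' := fun r x => rfl }
  let v' : Q →ₗ[(TrivSqZeroExt C E)ᵐᵒᵖ] C :=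
    { toFun := v, map_add' := v.map_add, map_smul' := fun r x => v.map_smulₛₗ r x }
  obtain ⟨g, hg⟩ := Module.projective_lifting_property p' v' (fun c => ⟨TrivSqZeroExt.inl c, rfl⟩)
  refine ⟨g, ?_⟩
  ext x
  exact LinearMap.congr_fun hg x

theorem mem_mE_of_fst {Q : Type} [AddCommGroup Q] [Module (TrivSqZeroExt C E)ᵐᵒᵖ Q]
    [Module.Finite (TrivSqZeroExt C E)ᵐᵒᵖ Q] [Module.Projective (TrivSqZeroExt C E)ᵐᵒᵖ Q]
    (x : Q) (h : ∀ v : Q →ₛₗ[piO C E] C, v x = 0) :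
    x ∈ mE (⊤ : Submodule (TrivSqZeroExt C E)ᵐᵒᵖ Q) := by
  obtain ⟨n, y, f, hf⟩ := dual_basis (A := TrivSqZeroExt C E) Q
  rw [hf x]
  refine AddSubgroup.sum_mem _ fun i _ => ?_
  have h1 : (f i x).fst = 0 := h (fstPart (f i))
  have h2 : f i x = TrivSqZeroExt.inr (f i x).snd := by ext <;> simp [h1]
  rw [h2]
  exact mem_mE Submodule.mem_top _

variable {k : Type} [Field k] [Algebra k C]
  [Module k E] [IsScalarTower k C E] [IsScalarTower k Cᵐᵒᵖ E]

/-- if `E` kills `Tr_B M` then `Hom(P0,E) → Hom(P1,E)` is onto -/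
theorem Cmp.ext_of_kill (c : Cmp d1 d0 D1 D0) {TrB : Type} [AddCommGroup TrB]
    [Module (TrivSqZeroExt C E) TrB]
    [Module.Finite (TrivSqZeroExt C E)ᵐᵒᵖ Q1] [Module.Projective (TrivSqZeroExt C E)ᵐᵒᵖ Q1]
    (q : (Q1 →ₗ[(TrivSqZeroExt C E)ᵐᵒᵖ] TrivSqZeroExt C E) →ₗ[TrivSqZeroExt C E] TrB)
    (hq : ∀ g, q g = 0 ↔ ∃ f : Q0 →ₗ[(TrivSqZeroExt C E)ᵐᵒᵖ] TrivSqZeroExt C E, g = f.comp D1)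
    (hE : ∀ (e : E) (x : TrB), (TrivSqZeroExt.inr e : TrivSqZeroExt C E) • x = 0)
    (g : P1 →ₗ[Cᵐᵒᵖ] E) : ∃ f : P0 →ₗ[Cᵐᵒᵖ] E, g = f.comp d1 := by
  obtain ⟨n, y, b, hb⟩ := dual_basis (A := TrivSqZeroExt C E) Q1
  let g' : P1 →ₗ[Cᵐᵒᵖ] E := g.comp c.w.symm.toLinearMap
  let u := inrLift (g'.comp c.h1)
  have hu : u = ∑ i, u (y i) • b i := by
    ext1 p
    rw [expand hb u p]
    simp
  have hqu : q u = 0 := by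
    rw [hu, map_sum]
    refine Finset.sum_eq_zero fun i _ => ?_
    rw [map_smul]
    exact hE _ _
  obtain ⟨f, hf⟩ := (hq u).1 hqu
  refine ⟨{ toFun := fun p => (f (c.s0 p)).snd, map_add' := by simp, map_smul' := fun a p => ?_ }, ?_⟩
  · rw [c.s0.map_smulₛₗ, map_smul]
    change (f (c.s0 p) * (TrivSqZeroExt.inl (unop a) : TrivSqZeroExt C E)).snd = _
    simp
  · ext p
    have := congrArg TrivSqZeroExt.snd (LinearMap.congr_fun hf (c.s1 p))
    rw [LinearMap.comp_apply, c.ds] at this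
    change _ = (f (c.s0 (d1 p))).snd
    rw [← this]
    change _ = g (c.w.symm (c.h1 (c.s1 p)))
    rw [c.hs1]; simp

theorem Cmp.forward (c : Cmp d1 d0 D1 D0) {TrB TrC TC TB : Type} [AddCommGroup TrB]
    [AddCommGroup TrC] [AddCommGroup TC] [AddCommGroup TB]
    [FiniteDimensional k C] [FiniteDimensional k E]
    [Module (TrivSqZeroExt C E) TrB] [Module C TrC] [Module (TrivSqZeroExt C E)ᵐᵒᵖ TB]
    [Module Cᵐᵒᵖ TC]
    [Module.Finite (TrivSqZeroExt C E)ᵐᵒᵖ Q1] [Module.Projective (TrivSqZeroExt C E)ᵐᵒᵖ Q1]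
    [Module.Finite Cᵐᵒᵖ P1] [Module.Projective Cᵐᵒᵖ P1]
    (q : (Q1 →ₗ[(TrivSqZeroExt C E)ᵐᵒᵖ] TrivSqZeroExt C E) →ₗ[TrivSqZeroExt C E] TrB)
    (hqs : Function.Surjective q)
    (hq : ∀ g, q g = 0 ↔ ∃ f : Q0 →ₗ[(TrivSqZeroExt C E)ᵐᵒᵖ] TrivSqZeroExt C E, g = f.comp D1)
    (r : (P1 →ₗ[Cᵐᵒᵖ] C) →ₗ[C] TrC) (hrs : Function.Surjective r)
    (hr : ∀ g, r g = 0 ↔ ∃ f : P0 →ₗ[Cᵐᵒᵖ] C, g = f.comp d1)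
    (hC : IskDual k C (ModuleCat.of _ TC) (ModuleCat.of _ TrC))
    (hB : IskDual k (TrivSqZeroExt C E) (ModuleCat.of _ TB) (ModuleCat.of _ TrB))
    (e : TC ≃+ TB) (he : ∀ (b : TrivSqZeroExt C E) t, e (op b.fst • t) = op b • e t) :
    mE (⊤ : Submodule (TrivSqZeroExt C E)ᵐᵒᵖ Q0) ≤ mE (LinearMap.ker D0) ∧
    ∀ g : P1 →ₗ[Cᵐᵒᵖ] E, ∃ f : P0 →ₗ[Cᵐᵒᵖ] E, g = f.comp d1 := by
  obtain ⟨φ, a1, a2, a3, a4, a5, a6⟩ := hB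
  obtain ⟨ρ, b1, b2, b3, b4, b5, b6⟩ := hC
  have : FiniteDimensional k (TrivSqZeroExt C E) :=
    inferInstanceAs (FiniteDimensional k (C × E))
  have := finite_dual (A := TrivSqZeroExt C E) Q1
  have := finite_dual (A := C) P1
  let _ : Module k TrB := Module.compHom TrB (algebraMap k (TrivSqZeroExt C E))
  let _ : Module k TrC := Module.compHom TrC (algebraMap k C)
  let _ : Module k TC := Module.compHom TC (algebraMap k Cᵐᵒᵖ)
  have : IsScalarTower k (TrivSqZeroExt C E) TrB := IsScalarTower.of_algebraMap_smul fun _ _ => rfl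
  have : IsScalarTower k C TrC := IsScalarTower.of_algebraMap_smul fun _ _ => rfl
  have : FiniteDimensional k (Q1 →ₗ[(TrivSqZeroExt C E)ᵐᵒᵖ] TrivSqZeroExt C E) :=
    Module.Finite.trans (TrivSqZeroExt C E) _
  have : FiniteDimensional k (P1 →ₗ[Cᵐᵒᵖ] C) := Module.Finite.trans C _
  have : FiniteDimensional k TrC :=
    Module.Finite.of_surjective (r.restrictScalars k) hrs
  obtain ⟨i1, i2⟩ := pairing_finrank (k := k) (X := TrC) (N := TC) ρ b1 b2 b3
    (fun x n m => (b4 (algebraMap k C x) n m).trans (b3 x n m)) b5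
  obtain ⟨i3, i4⟩ := pairing_finrank (k := k) (X := TC) (N := TrB) (fun x t => φ (e t) x)
    (fun n n' m => a2 _ _ _) (fun n m m' => by rw [map_add]; exact a1 _ _ _)
    (fun x n m => by
      have h1 : e (x • m) = op (algebraMap k (TrivSqZeroExt C E) x) • e m :=
        he (algebraMap k (TrivSqZeroExt C E) x) m
      rw [h1]
      exact (a4 _ _ _).trans (a3 _ _ _)) (fun x n m => a3 _ _ _)
    (fun x hx => a6 x fun n => by simpa using hx (e.symm n))
  have hk : ∀ x, c.h1 x = 0 → x ∈ mE (⊤ : Submodule (TrivSqZeroExt C E)ᵐᵒᵖ Q1) := by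
    let α : (Q1 →ₗ[(TrivSqZeroExt C E)ᵐᵒᵖ] TrivSqZeroExt C E) →ₗ[k] (Q1 →ₛₗ[piO C E] C) :=
      { toFun := fstPart
        map_add' := fun f g => by ext x; simp [fstPart]
        map_smul' := fun a f => by ext x; simp [fstPart] }
    let β : (P1 →ₗ[Cᵐᵒᵖ] C) →ₗ[k] (Q1 →ₛₗ[piO C E] C) :=
      { toFun := fun g => g.comp c.h1
        map_add' := fun f g => by ext x; simp
        map_smul' := fun a f => by ext x; simp }
    have hβ := surj_of_dims (q.restrictScalars k) hqs (r.restrictScalars k) hrs α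
      exists_fstPart β (by
        intro g g' hg
        ext p
        obtain ⟨x, rfl⟩ := c.h1surj p
        exact LinearMap.congr_fun hg x) (by
        intro u hu
        obtain ⟨f, rfl⟩ := (hq u).1 hu
        obtain ⟨f1, hf1⟩ := descend c.h0 (fun p => ⟨_, c.hs0 p⟩) c.kerh0 (fstPart f)
        refine ⟨f1.comp d1, (hr _).2 ⟨f1, rfl⟩, ?_⟩
        ext x
        change f1 (d1 (c.h1 x)) = _
        rw [c.dh1, hf1]; rfl) (i4.trans i2)
    intro x hx
    refine mem_mE_of_fst x fun v => ?_
    obtain ⟨g, rfl⟩ := hβ v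
    change g (c.h1 x) = 0
    rw [hx, map_zero]
  refine ⟨c.kerh1_tens hk, c.ext_of_kill q hq fun ε x => ?_⟩
  refine a6 _ fun n => ?_
  rw [← a4]
  have : op (TrivSqZeroExt.inr ε : TrivSqZeroExt C E) • n = 0 := by
    obtain ⟨t, rfl⟩ := e.surjective n
    rw [← he]; simp
  change φ (op (TrivSqZeroExt.inr ε : TrivSqZeroExt C E) • n) x = 0
  rw [this]
  simpa using a1 0 0 x

theorem Cmp.backward (c : Cmp d1 d0 D1 D0) {TrB TrC TC TB : Type} [AddCommGroup TrB]
    [AddCommGroup TrC] [AddCommGroup TC] [AddCommGroup TB]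
    [FiniteDimensional k C] [FiniteDimensional k E]
    [Module (TrivSqZeroExt C E) TrB] [Module C TrC] [Module (TrivSqZeroExt C E)ᵐᵒᵖ TB]
    [Module Cᵐᵒᵖ TC]
    [Module.Finite (TrivSqZeroExt C E)ᵐᵒᵖ Q1] [Module.Projective (TrivSqZeroExt C E)ᵐᵒᵖ Q1]
    [Module.Projective (TrivSqZeroExt C E)ᵐᵒᵖ Q0]
    [Module.Finite Cᵐᵒᵖ P1] [Module.Projective Cᵐᵒᵖ P1]
    (mD1 : ∀ N : Submodule _ Q1, N ⊔ LinearMap.ker D1 = ⊤ → N = ⊤)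
    (q : (Q1 →ₗ[(TrivSqZeroExt C E)ᵐᵒᵖ] TrivSqZeroExt C E) →ₗ[TrivSqZeroExt C E] TrB)
    (hqs : Function.Surjective q)
    (hq : ∀ g, q g = 0 ↔ ∃ f : Q0 →ₗ[(TrivSqZeroExt C E)ᵐᵒᵖ] TrivSqZeroExt C E, g = f.comp D1)
    (r : (P1 →ₗ[Cᵐᵒᵖ] C) →ₗ[C] TrC) (hrs : Function.Surjective r)
    (hr : ∀ g, r g = 0 ↔ ∃ f : P0 →ₗ[Cᵐᵒᵖ] C, g = f.comp d1)
    (hC : IskDual k C (ModuleCat.of _ TC) (ModuleCat.of _ TrC))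
    (hB : IskDual k (TrivSqZeroExt C E) (ModuleCat.of _ TB) (ModuleCat.of _ TrB))
    (hT : mE (⊤ : Submodule (TrivSqZeroExt C E)ᵐᵒᵖ Q0) ≤ mE (LinearMap.ker D0))
    (hX : ∀ g : P1 →ₗ[Cᵐᵒᵖ] E, ∃ f : P0 →ₗ[Cᵐᵒᵖ] E, g = f.comp d1) :
    ∃ e : TC ≃+ TB, ∀ (b : TrivSqZeroExt C E) t, e (op b.fst • t) = op b • e t := by
  obtain ⟨φ, a1, a2, a3, a4, a5, a6⟩ := hB
  obtain ⟨ρ, b1, b2, b3, b4, b5, b6⟩ := hC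
  have : FiniteDimensional k (TrivSqZeroExt C E) :=
    inferInstanceAs (FiniteDimensional k (C × E))
  have := finite_dual (A := TrivSqZeroExt C E) Q1
  have := finite_dual (A := C) P1
  let _ : Module k TrB := Module.compHom TrB (algebraMap k (TrivSqZeroExt C E))
  let _ : Module k TrC := Module.compHom TrC (algebraMap k C)
  let _ : Module k TC := Module.compHom TC (algebraMap k Cᵐᵒᵖ)
  let _ : Module k TB := Module.compHom TB (algebraMap k (TrivSqZeroExt C E)ᵐᵒᵖ)
  have : IsScalarTower k (TrivSqZeroExt C E) TrB := IsScalarTower.of_algebraMap_smul fun _ _ => rfl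
  have : IsScalarTower k C TrC := IsScalarTower.of_algebraMap_smul fun _ _ => rfl
  have : FiniteDimensional k (Q1 →ₗ[(TrivSqZeroExt C E)ᵐᵒᵖ] TrivSqZeroExt C E) :=
    Module.Finite.trans (TrivSqZeroExt C E) _
  have : FiniteDimensional k (P1 →ₗ[Cᵐᵒᵖ] C) := Module.Finite.trans C _
  have : FiniteDimensional k TrC :=
    Module.Finite.of_surjective (r.restrictScalars k) hrs
  have : FiniteDimensional k TrB :=
    Module.Finite.of_surjective (q.restrictScalars k) hqs
  have hk := c.tens_kerh1 mD1 hT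
  -- `Tr_B ≅ Tr_C`, constructed on representatives
  have hdesc : ∀ u : Q1 →ₗ[(TrivSqZeroExt C E)ᵐᵒᵖ] TrivSqZeroExt C E,
      ∃ g : P1 →ₗ[Cᵐᵒᵖ] C, ∀ x, g (c.h1 x) = (u x).fst :=
    fun u => descend c.h1 c.h1surj hk (fstPart u)
  have hzero : ∀ (u : Q1 →ₗ[(TrivSqZeroExt C E)ᵐᵒᵖ] TrivSqZeroExt C E) (g : P1 →ₗ[Cᵐᵒᵖ] C),
      (∀ x, g (c.h1 x) = (u x).fst) → (q u = 0 ↔ r g = 0) := by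
    intro u g hug
    rw [hq, hr]
    constructor
    · rintro ⟨f, rfl⟩
      obtain ⟨f1, hf1⟩ := descend c.h0 (fun p => ⟨_, c.hs0 p⟩) c.kerh0 (fstPart f)
      refine ⟨f1, ?_⟩
      ext p
      obtain ⟨x, rfl⟩ := c.h1surj p
      rw [hug, LinearMap.comp_apply, LinearMap.comp_apply, c.dh1, hf1]; rfl
    · rintro ⟨f, rfl⟩
      obtain ⟨f', hf'⟩ := exists_fstPart (f.comp c.h0)
      have hf'' : ∀ x, (f' x).fst = f (c.h0 x) := fun x => LinearMap.congr_fun hf' x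
      have hz : ∀ x, ((u - f'.comp D1) x).fst = 0 := by
        intro x
        simp only [LinearMap.sub_apply, TrivSqZeroExt.fst_sub, ← hug, LinearMap.comp_apply, hf'']
        rw [c.dh1, sub_self]
      let v : Q1 →ₛₗ[piO C E] E :=
        { toFun := fun x => ((u - f'.comp D1) x).snd
          map_add' := by intro x y; rw [map_add]; simp
          map_smul' := by
            intro b x
            rw [map_smul]
            have := hz x
            change ((u - f'.comp D1) x * unop b).snd = op (unop b).fst • ((u - f'.comp D1) x).snd
            rw [TrivSqZeroExt.snd_mul, this, zero_smul, zero_add] }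
      obtain ⟨g, hg⟩ := descend c.h1 c.h1surj hk v
      obtain ⟨F, hF⟩ := hX g
      refine ⟨f' + inrLift (F.comp c.h0), ?_⟩
      ext1 x
      have h2 : (u - f'.comp D1) x = inrLift (F.comp c.h0) (D1 x) := by
        ext
        · rw [hz]; rfl
        · change v x = F (c.h0 (D1 x))
          rw [← hg, hF, ← c.dh1]; rfl
      rw [LinearMap.comp_apply, LinearMap.add_apply, ← h2]
      simp
  choose G hG using hdesc
  have hwd : ∀ (u : Q1 →ₗ[(TrivSqZeroExt C E)ᵐᵒᵖ] TrivSqZeroExt C E) (g : P1 →ₗ[Cᵐᵒᵖ] C),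
      (∀ x, g (c.h1 x) = (u x).fst) → G u = g := by
    intro u g hug
    ext p
    obtain ⟨x, rfl⟩ := c.h1surj p
    rw [hG, hug]
  let S := Function.surjInv hqs
  have hS : ∀ x, q (S x) = x := Function.surjInv_eq hqs
  have hwd2 : ∀ u u', q u = q u' → r (G u) = r (G u') := by
    intro u u' h
    rw [← sub_eq_zero, ← map_sub] at h ⊢
    refine (hzero (u - u') _ ?_).1 h
    intro x; simp [hG]
  let θ : TrB →+ TrC := AddMonoidHom.mk' (fun x => r (G (S x))) (by
    intro a b
    rw [← map_add]
    rw [hwd2 (S (a + b)) (S a + S b) (by simp [hS])]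
    congr 1
    apply hwd
    intro x; simp [hG])
  have hθq : ∀ u, θ (q u) = r (G u) := fun u => hwd2 _ _ (hS _)
  have hθ : ∀ (b : TrivSqZeroExt C E) (x : TrB), θ (b • x) = b.fst • θ x := by
    intro b x
    obtain ⟨u, rfl⟩ := hqs x
    rw [← map_smul, hθq, hθq, ← map_smul]
    congr 1
    apply hwd
    intro x; simp [hG]
  have hθi : ∀ x, θ x = 0 → x = 0 := by
    intro x hx
    obtain ⟨u, rfl⟩ := hqs x
    rw [hθq] at hx
    exact (hzero u _ (hG u)).2 hx
  have hθs : Function.Surjective θ := by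
    intro y
    obtain ⟨g, rfl⟩ := hrs y
    obtain ⟨u, hu⟩ := exists_fstPart (g.comp c.h1)
    refine ⟨q u, ?_⟩
    rw [hθq]
    congr 1
    apply hwd
    intro x
    exact (LinearMap.congr_fun hu x).symm
  have hθk : ∀ (a : k) x, θ (a • x) = a • θ x := fun a x => hθ _ x
  let θk : TrB ≃ₗ[k] TrC := LinearEquiv.ofBijective
    ({ toFun := θ, map_add' := θ.map_add, map_smul' := hθk } : TrB →ₗ[k] TrC)
    ⟨(injective_iff_map_eq_zero θ).2 hθi, hθs⟩
  have hθk' : ∀ x, θk x = θ x := fun _ => rfl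
  -- dualise
  have φk : ∀ (x : k) (n : TB) (m : TrB), φ (x • n) m = x * φ n m :=
    fun x n m => (a4 (algebraMap k (TrivSqZeroExt C E) x) n m).trans (a3 x n m)
  have ρk : ∀ (x : k) (n : TC) (m : TrC), ρ (x • n) m = x * ρ n m :=
    fun x n m => (b4 (algebraMap k C x) n m).trans (b3 x n m)
  have ex1 : ∀ t : TC, ∃ s : TB, ∀ x, φ s x = ρ t (θ x) := by
    intro t
    exact pairing_surj (k := k) (X := TrB) (N := TB) φ a1 a2 a3 φk a6
      { toFun := fun x => ρ t (θ x), map_add' := fun x y => by rw [map_add]; exact b2 _ _ _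
        map_smul' := fun a x => by rw [hθk]; exact b3 _ _ _ }
  have ex2 : ∀ s : TB, ∃ t : TC, ∀ y, ρ t y = φ s (θk.symm y) := by
    intro s
    exact pairing_surj (k := k) (X := TrC) (N := TC) ρ b1 b2 b3 ρk b6
      { toFun := fun x => φ s (θk.symm x), map_add' := fun x y => by rw [map_add]; exact a2 _ _ _
        map_smul' := fun a x => by rw [map_smul]; exact a3 _ _ _ }
  have φsub : ∀ (s s' : TB), (∀ x, φ s x = φ s' x) → s = s' := by
    intro s s' h
    rw [← sub_eq_zero]
    refine a5 _ fun x => ?_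
    have := a1 (s - s') s' x
    change φ ((s - s' : TB) + s') x = _ at this
    rw [sub_add_cancel, h] at this
    simpa using this
  have ρsub : ∀ (s s' : TC), (∀ x, ρ s x = ρ s' x) → s = s' := by
    intro s s' h
    rw [← sub_eq_zero]
    refine b5 _ fun x => ?_
    have := b1 (s - s') s' x
    change ρ ((s - s' : TC) + s') x = _ at this
    rw [sub_add_cancel, h] at this
    simpa using this
  choose F hF using ex1
  choose F' hF' using ex2
  refine ⟨{ toFun := F, invFun := F', left_inv := fun t => ρsub _ _ fun y => ?_,
            right_inv := fun s => φsub _ _ fun x => ?_, map_add' := fun a b => φsub _ _ fun x => ?_ },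
            fun b t => φsub _ _ fun x => ?_⟩
  · rw [hF', hF, ← hθk', LinearEquiv.apply_symm_apply]
  · rw [hF, hF', ← hθk', LinearEquiv.symm_apply_apply]
  · rw [hF]
    exact (b1 _ _ _).trans (by rw [← hF, ← hF]; exact (a1 _ _ _).symm)
  · refine (hF _ _).trans ?_
    refine (b4 _ _ _).trans ?_
    refine Eq.trans ?_ (a4 b (F t) x).symm
    refine Eq.trans ?_ (hF _ _).symm
    rw [hθ]

end AZ
end RelExtProof

open CategoryTheory MulOpposite

namespace RelExtProof

section ExtGen

open Abelian

variable {R : Type} [Ring R]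

/-- `Ext²`. -/
abbrev E2 (X N : Mdl R) : Type := Ext.{0} X N 2

/-- contravariant functoriality of `Ext²` -/
noncomputable def pull {X Y : Mdl R} (N : Mdl R) (f : X →ₗ[R] Y) : E2 Y N →+ E2 X N :=
  (Ext.mk₀ (ModuleCat.ofHom f)).precomp N (zero_add 2)

/-- covariant functoriality of `Ext²` -/
noncomputable def push {N N' : Mdl R} (X : Mdl R) (f : N →ₗ[R] N') : E2 X N →+ E2 X N' :=
  (Ext.mk₀ (ModuleCat.ofHom f)).postcomp X (add_zero 2)

theorem pull_def {X Y N : Mdl R} (f : X →ₗ[R] Y) (x : E2 Y N) :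
    pull N f x = (Ext.mk₀ (ModuleCat.ofHom f)).comp x (zero_add 2) := rfl

theorem push_def {N N' X : Mdl R} (f : N →ₗ[R] N') (x : E2 X N) :
    push X f x = x.comp (Ext.mk₀ (ModuleCat.ofHom f)) (add_zero 2) := rfl

theorem pull_id {X N : Mdl R} (x : E2 X N) : pull N LinearMap.id x = x := by
  rw [pull_def]; exact Ext.mk₀_id_comp x

theorem pull_comp {X Y Z N : Mdl R} (g : Y →ₗ[R] Z) (f : X →ₗ[R] Y) (x : E2 Z N) :
    pull N (g.comp f) x = pull N f (pull N g x) := by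
  rw [pull_def, pull_def, pull_def, ModuleCat.ofHom_comp, ← Ext.mk₀_comp_mk₀_assoc]

theorem pull_add {X Y N : Mdl R} (f g : X →ₗ[R] Y) (x : E2 Y N) :
    pull N (f + g) x = pull N f x + pull N g x := by
  rw [pull_def, pull_def, pull_def, ModuleCat.ofHom_add, Ext.mk₀_add, Ext.add_comp]

theorem pull_zero {X Y N : Mdl R} (x : E2 Y N) :
    pull N (0 : X →ₗ[R] Y) x = 0 := by
  simpa using pull_add (0 : X →ₗ[R] Y) 0 x

theorem pull_sum {X Y N : Mdl R} {ι : Type} (s : Finset ι) (f : ι → (X →ₗ[R] Y)) (x : E2 Y N) :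
    pull N (∑ i ∈ s, f i) x = ∑ i ∈ s, pull N (f i) x := by
  classical
  induction s using Finset.induction_on with
  | empty => simp [pull_zero]
  | insert a s ha ih => rw [Finset.sum_insert ha, Finset.sum_insert ha, pull_add, ih]

theorem push_id {X N : Mdl R} (x : E2 X N) : push X LinearMap.id x = x := by
  rw [push_def]; exact Ext.comp_mk₀_id x

theorem push_comp {N N' N'' X : Mdl R} (g : N' →ₗ[R] N'') (f : N →ₗ[R] N') (x : E2 X N) :
    push X (g.comp f) x = push X g (push X f x) := by
  rw [push_def, push_def, push_def, ModuleCat.ofHom_comp, ← Ext.mk₀_comp_mk₀,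
    Ext.comp_assoc_of_second_deg_zero]

theorem push_add {N N' X : Mdl R} (f g : N →ₗ[R] N') (x : E2 X N) :
    push X (f + g) x = push X f x + push X g x := by
  rw [push_def, push_def, push_def, ModuleCat.ofHom_add, Ext.mk₀_add, Ext.comp_add]

theorem push_zero {N N' X : Mdl R} (x : E2 X N) :
    push X (0 : N →ₗ[R] N') x = 0 := by
  simpa using push_add (0 : N →ₗ[R] N') 0 x

theorem push_sum {N N' X : Mdl R} {ι : Type} (s : Finset ι) (f : ι → (N →ₗ[R] N')) (x : E2 X N) :
    push X (∑ i ∈ s, f i) x = ∑ i ∈ s, push X (f i) x := by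
  classical
  induction s using Finset.induction_on with
  | empty => simp [push_zero]
  | insert a s ha ih => rw [Finset.sum_insert ha, Finset.sum_insert ha, push_add, ih]

theorem pull_push {X Y N N' : Mdl R} (f : X →ₗ[R] Y) (g : N →ₗ[R] N') (x : E2 Y N) :
    pull N' f (push Y g x) = push X g (pull N f x) := by
  rw [pull_def, pull_def, push_def, push_def, Ext.comp_assoc_of_third_deg_zero]

/-- the short complex of two composable linear maps -/
def sc {X Y Z : Mdl R} (f : X →ₗ[R] Y) (g : Y →ₗ[R] Z) (h : LinearMap.range f = LinearMap.ker g) :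
    ShortComplex (Mdl R) :=
  ShortComplex.mk (ModuleCat.ofHom f) (ModuleCat.ofHom g) (by
    ext x
    have : f x ∈ LinearMap.ker g := h ▸ ⟨x, rfl⟩
    exact this)

theorem sc_exact {X Y Z : Mdl R} (f : X →ₗ[R] Y) (g : Y →ₗ[R] Z)
    (h : LinearMap.range f = LinearMap.ker g) (hf : Function.Injective f)
    (hg : Function.Surjective g) : (sc f g h).ShortExact where
  exact := by
    rw [ShortComplex.moduleCat_exact_iff_range_eq_ker]
    exact h
  mono_f := (ModuleCat.mono_iff_injective _).2 hf
  epi_g := (ModuleCat.epi_iff_surjective _).2 hg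

theorem proj_obj (P : Mdl R) [Module.Projective R P] : CategoryTheory.Projective P :=
  (IsProjective.iff_projective P).1 inferInstance

theorem pd_of_PdLE2 {X : Mdl R} (h : PdLE2 R X) : HasProjectiveDimensionLT X 3 := by
  obtain ⟨P2, P1, P0, d2, d1, d0, p2, p1, p0, i2, s0, e2, e1⟩ := h
  have hd1 : ∀ x, d1 x ∈ LinearMap.ker d0 := fun x => e1 ▸ ⟨x, rfl⟩
  have E0 := sc_exact (X := ModuleCat.of R (LinearMap.ker d0)) (LinearMap.ker d0).subtype d0
    (by simp) (Submodule.injective_subtype _) s0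
  have E1 := sc_exact (Z := ModuleCat.of R (LinearMap.ker d0)) d2 (d1.codRestrict _ hd1)
    (by rw [LinearMap.ker_codRestrict]; exact e2) i2 (by
      rintro ⟨y, hy⟩
      obtain ⟨x, rfl⟩ := e1.symm ▸ hy
      exact ⟨x, rfl⟩)
  have q0 := proj_obj P0
  have q1 := proj_obj P1
  have q2 := proj_obj P2
  refine (E0.hasProjectiveDimensionLT_X₃_iff 1 q0).2 ?_
  refine (E1.hasProjectiveDimensionLT_X₃_iff 0 q1).2 ?_
  exact projective_iff_hasProjectiveDimensionLT_one.1 q2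

theorem E2_zero_of_PdLE1 {X : Mdl R} (h : PdLE1 R X) (N : Mdl R) (x : E2 X N) : x = 0 := by
  obtain ⟨P1, P0, d1, d0, p1, p0, i1, s0, e1⟩ := h
  have q0 := proj_obj P0
  have q1 := proj_obj P1
  have : HasProjectiveDimensionLT X 2 := ((sc_exact d1 d0 e1 i1 s0).hasProjectiveDimensionLT_X₃_iff 0 q0).2
    (projective_iff_hasProjectiveDimensionLT_one.1 q1)
  exact x.eq_zero_of_hasProjectiveDimensionLT 2 le_rfl

theorem inj_obj (I : Mdl R) (h : Module.Injective R I) : CategoryTheory.Injective I :=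
  (Module.injective_iff_injective_object R I).1 h

theorem E2_zero_of_IdLE1 {N : Mdl R} (h : IdLE1 R N) (X : Mdl R) (x : E2 X N) : x = 0 := by
  obtain ⟨I0, I1, d0, d1, p0, p1, i0, s1, e⟩ := h
  have q0 := inj_obj I0 p0
  have q1 := inj_obj I1 p1
  have : HasInjectiveDimensionLT N 2 := (sc_exact d0 d1 e i0 s1).hasInjectiveDimensionLT_X₁ 1
    (injective_iff_hasInjectiveDimensionLT_one.1 q1) (show HasInjectiveDimensionLT I0 2 from inferInstance)
  exact x.eq_zero_of_hasInjectiveDimensionLT 2 le_rfl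

theorem pull_exact {X Y Z N : Mdl R} (f : X →ₗ[R] Y) (g : Y →ₗ[R] Z)
    (h : LinearMap.range f = LinearMap.ker g) (hf : Function.Injective f)
    (hg : Function.Surjective g) (x : E2 Y N) (hx : pull N f x = 0) : ∃ y : E2 Z N, pull N g y = x :=
  Ext.contravariant_sequence_exact₂ (sc_exact f g h hf hg) N x hx

theorem pull_surj (hgl : GlDimLE2 R) {X Y : Mdl R} (N : Mdl R) (f : X →ₗ[R] Y)
    (hf : Function.Injective f) : Function.Surjective (pull N f) := by
  intro x
  have E0 := sc_exact (Z := ModuleCat.of R (Y ⧸ LinearMap.range f)) f (LinearMap.range f).mkQ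
    (by simp) hf (Submodule.mkQ_surjective _)
  have := pd_of_PdLE2 (hgl (ModuleCat.of R (Y ⧸ LinearMap.range f)))
  exact Ext.contravariant_sequence_exact₁ E0 N x (n₁ := 3) rfl
    (Ext.eq_zero_of_hasProjectiveDimensionLT (X := ModuleCat.of R (Y ⧸ LinearMap.range f)) _ 3 le_rfl)

/-- length two projective resolutions -/
structure Res {P2 P1 P0 X : Mdl R} (d2 : P2 →ₗ[R] P1) (d1 : P1 →ₗ[R] P0) (d0 : P0 →ₗ[R] X) : Prop where
  p2 : Module.Projective R P2
  p1 : Module.Projective R P1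
  p0 : Module.Projective R P0
  i2 : Function.Injective d2
  s0 : Function.Surjective d0
  e2 : LinearMap.range d2 = LinearMap.ker d1
  e1 : LinearMap.range d1 = LinearMap.ker d0

variable {P2 P1 P0 X : Mdl R} {d2 : P2 →ₗ[R] P1} {d1 : P1 →ₗ[R] P0} {d0 : P0 →ₗ[R] X}

/-- the map onto the first syzygy -/
def Res.c1 (h : Res d2 d1 d0) : P1 →ₗ[R] LinearMap.ker d0 :=
  d1.codRestrict _ fun x => h.e1 ▸ ⟨x, rfl⟩

theorem Res.c1s (h : Res d2 d1 d0) : Function.Surjective h.c1 := by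
  rintro ⟨y, hy⟩
  obtain ⟨x, rfl⟩ := h.e1.symm ▸ hy
  exact ⟨x, rfl⟩

theorem Res.x0 (h : Res d2 d1 d0) : (sc (X := ModuleCat.of R (LinearMap.ker d0))
    (LinearMap.ker d0).subtype d0 (by simp)).ShortExact :=
  sc_exact _ _ _ (Submodule.injective_subtype _) h.s0

theorem Res.x1 (h : Res d2 d1 d0) : (sc (Z := ModuleCat.of R (LinearMap.ker d0))
    d2 h.c1 (by rw [Res.c1, LinearMap.ker_codRestrict]; exact h.e2)).ShortExact :=
  sc_exact _ _ _ h.i2 h.c1s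

/-- the first syzygy -/
abbrev syz {P0 X : Mdl R} (d0 : P0 →ₗ[R] X) : Mdl R := ModuleCat.of R (LinearMap.ker d0)

/-- the class of the first step -/
noncomputable def Res.e0 (h : Res d2 d1 d0) : Ext.{0} X (syz d0) 1 := h.x0.extClass

/-- the class of the second step -/
noncomputable def Res.f0 (h : Res d2 d1 d0) : Ext.{0} (syz d0) P2 1 := h.x1.extClass

/-- the class of the resolution -/
noncomputable def Res.kap (h : Res d2 d1 d0) : E2 X P2 :=
  h.e0.comp h.f0 (by norm_num)

theorem Res.push_kap (h : Res d2 d1 d0) {N : Mdl R} (g : P2 →ₗ[R] N) :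
    push X g h.kap = h.e0.comp (h.f0.comp (Ext.mk₀ (ModuleCat.ofHom g)) (add_zero 1))
      (by norm_num) := by
  rw [push_def, Res.kap]
  exact Ext.comp_assoc _ _ _ _ _ (by norm_num)

theorem Res.kap_surj (h : Res d2 d1 d0) {N : Mdl R} (x : E2 X N) : ∃ g : P2 →ₗ[R] N,
    push X g h.kap = x := by
  have q0 := @proj_obj R _ P0 h.p0
  have q1 := @proj_obj R _ P1 h.p1
  obtain ⟨y, hy⟩ := Ext.contravariant_sequence_exact₃ h.x0 N x
    (Ext.eq_zero_of_hasProjectiveDimensionLT (X := P0) _ 1 (by norm_num)) (n₀ := 1) (by norm_num)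
  obtain ⟨z, hz⟩ := Ext.contravariant_sequence_exact₃ h.x1 N y
    (Ext.eq_zero_of_hasProjectiveDimensionLT (X := P1) _ 1 (by norm_num)) (n₀ := 0) (by norm_num)
  obtain ⟨g, rfl⟩ := Ext.homEquiv₀.symm.surjective z
  let g' : P2 →ₗ[R] N := ModuleCat.Hom.hom g
  refine ⟨g', ?_⟩
  rw [h.push_kap, ← hy, ← hz]
  rfl

theorem Res.kap_zero (h : Res d2 d1 d0) {N : Mdl R} (g : P2 →ₗ[R] N) :
    push X g h.kap = 0 ↔ ∃ f : P1 →ₗ[R] N, g = f.comp d2 := by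
  have q0 := @proj_obj R _ P0 h.p0
  rw [h.push_kap]
  constructor
  · intro hz
    obtain ⟨y, hy⟩ := Ext.contravariant_sequence_exact₁ h.x0 N _ _ hz
    have hy0 : y = 0 := Ext.eq_zero_of_hasProjectiveDimensionLT (X := P0) _ 1 (by norm_num)
    rw [hy0, Ext.comp_zero] at hy
    obtain ⟨z, hz⟩ := Ext.contravariant_sequence_exact₁ h.x1 N _ _ hy.symm
    obtain ⟨f, rfl⟩ := Ext.homEquiv₀.symm.surjective z
    refine ⟨f.hom, ?_⟩
    rw [Ext.homEquiv₀_symm_apply, Ext.mk₀_comp_mk₀] at hz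
    have := congrArg ModuleCat.Hom.hom (Ext.homEquiv₀.symm.injective hz)
    exact this.symm
  · rintro ⟨f, rfl⟩
    have : h.f0.comp (Ext.mk₀ (ModuleCat.ofHom (f.comp d2))) (add_zero 1) = 0 := by
      rw [ModuleCat.ofHom_comp, ← Ext.mk₀_comp_mk₀]
      exact h.x1.extClass_comp_assoc _
    rw [this, Ext.comp_zero]

theorem Res.kap_nat {P2' P1' P0' X' : Mdl R} {d2' : P2' →ₗ[R] P1'} {d1' : P1' →ₗ[R] P0'}
    {d0' : P0' →ₗ[R] X'} (h : Res d2 d1 d0) (h' : Res d2' d1' d0')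
    (μ : X →ₗ[R] X') (f0 : P0 →ₗ[R] P0') (f1 : P1 →ₗ[R] P1') (f2 : P2 →ₗ[R] P2')
    (c0 : d0'.comp f0 = μ.comp d0) (c1 : d1'.comp f1 = f0.comp d1)
    (c2 : d2'.comp f2 = f1.comp d2) : push X f2 h.kap = pull P2' μ h'.kap := by
  let κ : LinearMap.ker d0 →ₗ[R] LinearMap.ker d0' := f0.restrict (by
    intro x hx
    rw [LinearMap.mem_ker] at hx ⊢
    have := LinearMap.congr_fun c0 x
    simp only [LinearMap.comp_apply] at this
    rw [this, hx, map_zero])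
  let K : syz d0 ⟶ syz d0' := ModuleCat.ofHom κ
  have n0 : h.e0.comp (Ext.mk₀ K) (add_zero 1) =
      (Ext.mk₀ (ModuleCat.ofHom μ)).comp h'.e0 (zero_add 1) :=
    ShortComplex.ShortExact.extClass_naturality h.x0 h'.x0
    { τ₁ := ModuleCat.ofHom κ
      τ₂ := ModuleCat.ofHom f0
      τ₃ := ModuleCat.ofHom μ
      comm₁₂ := by ext x; rfl
      comm₂₃ := by ext x; exact LinearMap.congr_fun c0 x }
  have n1 : h.f0.comp (Ext.mk₀ (ModuleCat.ofHom f2)) (add_zero 1) =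
      (Ext.mk₀ K).comp h'.f0 (zero_add 1) :=
    ShortComplex.ShortExact.extClass_naturality h.x1 h'.x1
    { τ₁ := ModuleCat.ofHom f2
      τ₂ := ModuleCat.ofHom f1
      τ₃ := ModuleCat.ofHom κ
      comm₁₂ := by ext x; exact LinearMap.congr_fun c2 x
      comm₂₃ := by ext x; exact Subtype.ext (LinearMap.congr_fun c1 x) }
  rw [h.push_kap, n1, pull_def, Res.kap,
    ← Ext.comp_assoc h.e0 (Ext.mk₀ K) h'.f0 (add_zero 1) (zero_add 1) (by norm_num), n0]
  exact Ext.comp_assoc (Ext.mk₀ (ModuleCat.ofHom μ)) h'.e0 h'.f0 (zero_add 1)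
    (show 1 + 1 = 2 from rfl) (by norm_num)

/-- finitely generated resolutions -/
theorem exists_res [IsNoetherianRing R] (hgl : GlDimLE2 R) (X : Mdl R) [Module.Finite R X] :
    ∃ (P2 P1 P0 : Mdl R) (d2 : P2 →ₗ[R] P1) (d1 : P1 →ₗ[R] P0) (d0 : P0 →ₗ[R] X),
      Module.Finite R P2 ∧ Module.Finite R P1 ∧ Module.Finite R P0 ∧ Res d2 d1 d0 := by
  obtain ⟨n, f, hf⟩ := Module.Finite.exists_fin' R X
  obtain ⟨m, g, hg⟩ := Module.Finite.exists_fin' R (LinearMap.ker f)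
  have E0 := sc_exact (X := ModuleCat.of R (LinearMap.ker f)) (Y := ModuleCat.of R (Fin n → R))
    (LinearMap.ker f).subtype f (by simp) (Submodule.injective_subtype _) hf
  have E1 := sc_exact (Z := ModuleCat.of R (LinearMap.ker f)) (Y := ModuleCat.of R (Fin m → R))
    (X := ModuleCat.of R (LinearMap.ker g))
    (LinearMap.ker g).subtype g (by simp) (Submodule.injective_subtype _) hg
  have h0 := pd_of_PdLE2 (hgl X)
  have h1 := (E0.hasProjectiveDimensionLT_X₃_iff 1 (proj_obj (ModuleCat.of R (Fin n → R)))).1 h0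
  have h2 := (E1.hasProjectiveDimensionLT_X₃_iff 0 (proj_obj (ModuleCat.of R (Fin m → R)))).1 h1
  have h3 : Module.Projective R (LinearMap.ker g) :=
    (IsProjective.iff_projective (LinearMap.ker g)).2
      (projective_iff_hasProjectiveDimensionLT_one.2 h2)
  refine ⟨ModuleCat.of R (LinearMap.ker g), ModuleCat.of R (Fin m → R), ModuleCat.of R (Fin n → R),
    (LinearMap.ker g).subtype, (LinearMap.ker f).subtype.comp g, f,
    inferInstanceAs (Module.Finite R (LinearMap.ker g)),
    inferInstanceAs (Module.Finite R (Fin m → R)), inferInstanceAs (Module.Finite R (Fin n → R)),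
    h3, inferInstanceAs (Module.Projective R (Fin m → R)),
    inferInstanceAs (Module.Projective R (Fin n → R)), Submodule.injective_subtype _, hf, ?_, ?_⟩
  · rw [Submodule.range_subtype, LinearMap.ker_comp_of_ker_eq_bot _ (Submodule.ker_subtype _)]
  · rw [LinearMap.range_comp_of_range_eq_top _ (LinearMap.range_eq_top.2 hg), Submodule.range_subtype]

theorem PdLE1_of_E2 [IsNoetherianRing R] (hgl : GlDimLE2 R) (X : Mdl R) [Module.Finite R X]
    (hX : ∀ x : E2 X (ModuleCat.of R R), x = 0) : PdLE1 R X := by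
  obtain ⟨P2, P1, P0, d2, d1, d0, F2, F1, F0, h⟩ := exists_res hgl X
  have := h.p2
  obtain ⟨n, f, g, -, -, hfg⟩ := Module.Finite.exists_comp_eq_id_of_projective R P2
  have key : h.kap = 0 := by
    have e1 : (LinearMap.id : P2 →ₗ[R] P2) = ∑ i : Fin n,
        (f.comp (LinearMap.single R (fun _ => R) i)).comp ((LinearMap.proj i).comp g) := by
      ext x
      conv_lhs => rw [← hfg]
      simp only [LinearMap.comp_apply, LinearMap.sum_apply]
      rw [← map_sum]
      congr 1
      ext j
      simp [Finset.sum_apply, Pi.single_apply]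
    rw [← push_id h.kap, e1, push_sum]
    refine Finset.sum_eq_zero fun i _ => ?_
    rw [push_comp (N' := ModuleCat.of R R), hX (push X _ h.kap), map_zero]
  obtain ⟨r, hr⟩ := (h.kap_zero LinearMap.id).1 (by rw [key, map_zero])
  have E0 := h.x0
  have E1 := h.x1
  have : HasProjectiveDimensionLT X 2 := by
    have : ∀ (N : Mdl R) (x : E2 X N), x = 0 := by
      intro N x
      obtain ⟨g, rfl⟩ := h.kap_surj x
      rw [key, map_zero]
    have h3 := pd_of_PdLE2 (hgl X)
    refine HasProjectiveDimensionLT.mk fun i hi Y e => ?_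
    obtain rfl | hi := eq_or_lt_of_le hi
    · exact this Y e
    · exact e.eq_zero_of_hasProjectiveDimensionLT 3 hi
  have q := (h.x0.hasProjectiveDimensionLT_X₃_iff 0 (@proj_obj R _ P0 h.p0)).1 this
  have q' : Module.Projective R (LinearMap.ker d0) :=
    (IsProjective.iff_projective (LinearMap.ker d0)).2
      (projective_iff_hasProjectiveDimensionLT_one.2 q)
  exact ⟨ModuleCat.of R (LinearMap.ker d0), P0, (LinearMap.ker d0).subtype, d0, q', h.p0,
    Submodule.injective_subtype _, h.s0, Submodule.range_subtype _⟩

/-- injective dimension from vanishing on cyclic modules -/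
theorem IdLE1_of_E2 (N : Mdl R)
    (hN : ∀ (J : Ideal R) (x : E2 (ModuleCat.of R (R ⧸ J)) N), x = 0) : IdLE1 R N := by
  let I := Injective.under N
  let i : N →ₗ[R] I := (Injective.ι N).hom
  have hi : Function.Injective i := (ModuleCat.mono_iff_injective _).1 inferInstance
  let W := ModuleCat.of R (I ⧸ LinearMap.range i)
  have E := sc_exact (Z := W) i (LinearMap.range i).mkQ (Submodule.ker_mkQ _).symm hi (Submodule.mkQ_surjective _)
  have hI : Injective I := Injective.injective_under N
  refine ⟨I, W, i, (LinearMap.range i).mkQ, (Module.injective_iff_injective_object R I).2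
    hI, ?_, hi, Submodule.mkQ_surjective _, (Submodule.ker_mkQ _).symm⟩
  have hext : ∀ (J : Ideal R) (x : Ext (ModuleCat.of R (R ⧸ J)) W 1), x = 0 := by
    intro J x
    obtain ⟨y, hy⟩ := Ext.covariant_sequence_exact₃ _ E x (n₁ := 2) rfl (hN J _)
    have : y = 0 := Ext.eq_zero_of_hasInjectiveDimensionLT (X := I) y 1 le_rfl
    rw [← hy, this, Ext.zero_comp]
    rfl
  refine Module.Baer.injective fun J g => ?_
  have EJ := sc_exact (X := ModuleCat.of R J) (Y := ModuleCat.of R R) (Z := ModuleCat.of R (R ⧸ J))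
    (Submodule.subtype J) (Submodule.mkQ J) (by simp) (Submodule.injective_subtype _)
    (Submodule.mkQ_surjective _)
  obtain ⟨y, hy⟩ := Ext.contravariant_sequence_exact₁ EJ W
    (Ext.mk₀ (ModuleCat.ofHom (X := J) (Y := W) g)) (n₁ := 1) rfl (hext J _)
  obtain ⟨f, rfl⟩ := Ext.homEquiv₀.symm.surjective y
  rw [Ext.homEquiv₀_symm_apply, Ext.mk₀_comp_mk₀] at hy
  have := congrArg ModuleCat.Hom.hom (Ext.homEquiv₀.symm.injective hy)
  exact ⟨f.hom, fun x hx => LinearMap.congr_fun this ⟨x, hx⟩⟩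

end ExtGen
end RelExtProof

open CategoryTheory MulOpposite

namespace RelExtProof

section Pairings

variable {k : Type} [Field k] {C : Type} [Ring C] [Algebra k C]

/-- perfect balanced pairings (the right module `N` is the dual of the left module `U`) -/
structure Pr {N U : Type} [AddCommGroup N] [AddCommGroup U] [Module Cᵐᵒᵖ N] [Module C U]
    (φ : N → U → k) : Prop where
  h1 : ∀ n n' m, φ (n + n') m = φ n m + φ n' m
  h2 : ∀ n m m', φ n (m + m') = φ n m + φ n m'
  h3 : ∀ (c : k) n m, φ n ((algebraMap k C c) • m) = c * φ n m
  h4 : ∀ (a : C) n m, φ (op a • n) m = φ n (a • m)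
  h5 : ∀ n, (∀ m, φ n m = 0) → n = 0
  h6 : ∀ m, (∀ n, φ n m = 0) → m = 0

variable {N U : Type} [AddCommGroup N] [AddCommGroup U] [Module Cᵐᵒᵖ N] [Module C U]
  {φ : N → U → k}

theorem Pr.ext (h : Pr (C := C) φ) {n n' : N} (e : ∀ u, φ n u = φ n' u) : n = n' := by
  rw [← sub_eq_zero]
  refine h.h5 _ fun m => ?_
  have := h.h1 (n - n') n' m
  rw [sub_add_cancel, e m] at this
  simpa using this

theorem Pr.finite [FiniteDimensional k C] (h : Pr (C := C) φ) [Module.Finite C U] :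
    Module.Finite Cᵐᵒᵖ N := by
  let _ : Module k N := Module.compHom N (algebraMap k Cᵐᵒᵖ)
  let _ : Module k U := Module.compHom U (algebraMap k C)
  have t1 : IsScalarTower k C U := ⟨fun a b u => by
    rw [Algebra.smul_def, mul_smul]; rfl⟩
  have t2 : IsScalarTower k Cᵐᵒᵖ N := ⟨fun a b u => by
    rw [Algebra.smul_def, mul_smul]; rfl⟩
  have : FiniteDimensional k U := Module.Finite.trans C U
  have := (pairing_finrank φ h.h1 h.h2 h.h3 (fun c n m => by
    rw [← h.h3]; exact h.h4 _ _ _) h.h5).1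
  exact Module.Finite.of_restrictScalars_finite k Cᵐᵒᵖ N

theorem Pr.surj [FiniteDimensional k C] (h : Pr (C := C) φ) [Module.Finite C U]
    (f : U → k) (hf : ∀ x y, f (x + y) = f x + f y)
    (hf' : ∀ (c : k) m, f ((algebraMap k C c) • m) = c * f m) : ∃ n, ∀ u, φ n u = f u := by
  let _ : Module k N := Module.compHom N (algebraMap k Cᵐᵒᵖ)
  let _ : Module k U := Module.compHom U (algebraMap k C)
  have t1 : IsScalarTower k C U := ⟨fun a b u => by
    rw [Algebra.smul_def, mul_smul]; rfl⟩
  have : FiniteDimensional k U := Module.Finite.trans C U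
  exact pairing_surj φ h.h1 h.h2 h.h3 (fun c n m => by
    rw [← h.h3]; exact h.h4 _ _ _) h.h6 { toFun := f, map_add' := hf, map_smul' := hf' }

theorem Pr.lift [FiniteDimensional k C] (h : Pr (C := C) φ) [Module.Finite C U]
    {X : Type} [AddCommGroup X] [Module Cᵐᵒᵖ X] (θ : X → U → k)
    (t1 : ∀ n n' m, θ (n + n') m = θ n m + θ n' m)
    (t2 : ∀ n m m', θ n (m + m') = θ n m + θ n m')
    (t3 : ∀ (c : k) n m, θ n ((algebraMap k C c) • m) = c * θ n m)
    (t4 : ∀ (a : C) n m, θ (op a • n) m = θ n (a • m)) :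
    ∃ u : X →ₗ[Cᵐᵒᵖ] N, ∀ x m, φ (u x) m = θ x m := by
  choose u hu using fun x => h.surj (θ x) (t2 x) (t3 · x)
  refine ⟨{ toFun := u, map_add' := ?_, map_smul' := ?_ }, hu⟩
  · intro x y
    refine h.ext fun m => ?_
    rw [h.h1, hu, hu, hu, t1]
  · intro a x
    refine h.ext fun m => ?_
    induction a using MulOpposite.rec' with
    | _ a => rw [hu, t4, RingHom.id_apply, h.h4, hu]

theorem Pr.embed [FiniteDimensional k C] {φ : N → C → k} (h : Pr (C := C) φ)
    (X : Type) [AddCommGroup X] [Module Cᵐᵒᵖ X] [Module.Finite Cᵐᵒᵖ X] :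
    ∃ (n : ℕ) (i : X →ₗ[Cᵐᵒᵖ] (Fin n → N)), Function.Injective i := by
  let _ : Module k X := Module.compHom X (algebraMap k Cᵐᵒᵖ)
  have t2 : IsScalarTower k Cᵐᵒᵖ X := ⟨fun a b u => by
    rw [Algebra.smul_def, mul_smul]; rfl⟩
  have : FiniteDimensional k Cᵐᵒᵖ := Module.Finite.equiv (MulOpposite.opLinearEquiv k)
  have : FiniteDimensional k X := Module.Finite.trans Cᵐᵒᵖ X
  let b := Module.finBasis k X
  have key : ∀ j, ∃ u : X →ₗ[Cᵐᵒᵖ] N, ∀ x m, φ (u x) m = b.coord j (op m • x) := fun j => by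
    refine h.lift (fun x m => b.coord j (op m • x)) ?_ ?_ ?_ ?_
    · intro n n' m; simp only [smul_add, map_add]
    · intro n m m'; simp only [MulOpposite.op_add, add_smul, map_add]
    · intro c n m
      have : op ((algebraMap k C c) • m) • n = c • (op m • n) := by
        rw [smul_eq_mul, Algebra.commutes, op_mul, mul_smul]; rfl
      rw [this, map_smul, smul_eq_mul]
    · intro a n m
      simp only [smul_eq_mul, op_mul, mul_smul]
  choose u hu using key
  refine ⟨_, LinearMap.pi u, ?_⟩
  rw [injective_iff_map_eq_zero]
  intro x hx
  refine b.ext_elem fun j => ?_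
  have e := hu j x 1
  have : u j x = 0 := congrFun hx j
  have z : φ 0 1 = 0 := by simpa using h.h1 0 0 1
  rw [this, z, op_one, one_smul] at e
  simpa using e.symm

end Pairings

section Lam

variable {k : Type} [Field k] {C : Type} [Ring C] [Algebra k C]
  {E : Type} [AddCommGroup E] [Module C E] [Module Cᵐᵒᵖ E]

/-- `C` as a right module -/
abbrev CC (C : Type) [Ring C] : Mdl Cᵐᵒᵖ := ModuleCat.of Cᵐᵒᵖ C

/-- left multiplication -/
def Lm (c : C) : CC C →ₗ[Cᵐᵒᵖ] CC C where
  toFun x := (c * x : C)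
  map_add' x y := mul_add (R := C) c x y
  map_smul' a x := (mul_assoc (G := C) c x a.unop).symm

/-- identification of `E` with `Ext²(DC,C)` -/
structure LamData {DC : Mdl Cᵐᵒᵖ} (φ : DC → C → k) (lam : E ≃+ E2 DC (CC C)) : Prop where
  pr : Pr (C := C) φ
  left : ∀ c e, lam (c • e) = push DC (Lm c) (lam e)
  right : ∀ (c : C) (μ : DC →ₗ[Cᵐᵒᵖ] DC), (∀ n x, φ (μ n) x = φ n (x * c)) →
    ∀ e, lam (op c • e) = pull _ μ (lam e)

theorem exists_lam (hE : IsRelExt k C E) : ∃ (DC : Mdl Cᵐᵒᵖ) (φ : DC → C → k)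
    (lam : E ≃+ E2 DC (CC C)), LamData φ lam := by
  obtain ⟨DC, φ, h1, h2, h3, h4, h5, h6, P2, P1, P0, d2, d1, d0, p2, p1, p0, i2, s0, e2, e1,
    q, hqs, hq, hr⟩ := hE
  have h : Res d2 d1 d0 := ⟨p2, p1, p0, i2, s0, e2, e1⟩
  have pr : Pr (C := C) φ := ⟨h1, h2, h3, h4, h5, h6⟩
  let G : (P2 →ₗ[Cᵐᵒᵖ] CC C) →+ E2 DC (CC C) :=
    AddMonoidHom.mk' (fun g => push DC g h.kap) fun g g' => push_add g g' h.kap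
  have hG : ∀ g : P2 →ₗ[Cᵐᵒᵖ] C, G g = 0 ↔ q g = 0 := fun g =>
    (h.kap_zero (N := CC C) g).trans (hq g).symm
  have hG2 : ∀ g g' : P2 →ₗ[Cᵐᵒᵖ] C, G g = G g' ↔ q g = q g' := fun g g' => by
    rw [← sub_eq_zero, ← sub_eq_zero (a := q g), ← map_sub, ← map_sub, ← hG]
  let s := Function.surjInv hqs
  have hs : ∀ e, q (s e) = e := Function.surjInv_eq hqs
  let lam0 : E →+ E2 DC (CC C) := AddMonoidHom.mk' (fun e => G (s e)) fun a b => by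
    rw [← map_add]
    exact (hG2 _ _).2 (by rw [map_add, hs, hs, hs])
  have hl : ∀ g : P2 →ₗ[Cᵐᵒᵖ] C, lam0 (q g) = push DC (N' := CC C) g h.kap := fun g =>
    (hG2 _ _).2 (hs _)
  have hb : Function.Bijective lam0 := by
    constructor
    · intro a b hab
      rw [← hs a, ← hs b]
      exact (hG2 _ _).1 hab
    · intro x
      obtain ⟨g, hg⟩ := h.kap_surj x
      exact ⟨q g, (hl g).trans hg⟩
  refine ⟨DC, φ, AddEquiv.ofBijective lam0 hb, pr, ?_, ?_⟩
  · intro c e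
    obtain ⟨g, rfl⟩ := hqs e
    show lam0 (c • q g) = push DC (Lm c) (lam0 (q g))
    rw [← map_smul, hl, hl, ← push_comp]
    rfl
  · intro c μ hμ e
    obtain ⟨g, rfl⟩ := hqs e
    show lam0 (op c • q g) = pull _ μ (lam0 (q g))
    obtain ⟨μ', f0, f1, f2, hμ', c0, c1, c2, hf⟩ := hr c
    have : μ = μ' := LinearMap.ext fun n => pr.ext fun x => by rw [hμ, hμ']
    subst this
    rw [← hf, hl, hl, pull_push, ← h.kap_nat h μ f0 f1 f2 c0 c1 c2, ← push_comp]

variable [FiniteDimensional k C] {DC : Mdl Cᵐᵒᵖ} {φ : DC → C → k} {lam : E ≃+ E2 DC (CC C)}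

theorem noeth (k C : Type) [Field k] [Ring C] [Algebra k C] [FiniteDimensional k C] :
    IsNoetherianRing Cᵐᵒᵖ := by
  have : FiniteDimensional k Cᵐᵒᵖ := Module.Finite.equiv (MulOpposite.opLinearEquiv k)
  exact IsNoetherianRing.of_finite k Cᵐᵒᵖ

/-- a finitely generated presentation of `E` -/
theorem LamData.pres (H : LamData φ lam) (hgl : GlDimLE2 Cᵐᵒᵖ) :
    ∃ (P2 P1 P0 : Mdl Cᵐᵒᵖ) (d2 : P2 →ₗ[Cᵐᵒᵖ] P1) (d1 : P1 →ₗ[Cᵐᵒᵖ] P0)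
      (d0 : P0 →ₗ[Cᵐᵒᵖ] DC) (q : (P2 →ₗ[Cᵐᵒᵖ] C) →ₗ[C] E),
      Module.Finite Cᵐᵒᵖ P2 ∧ Module.Finite Cᵐᵒᵖ P1 ∧ Res d2 d1 d0 ∧
      Function.Surjective q ∧
      ∀ g : P2 →ₗ[Cᵐᵒᵖ] C, q g = 0 ↔ ∃ f : P1 →ₗ[Cᵐᵒᵖ] C, g = f.comp d2 := by
  have := noeth k C
  have : Module.Finite Cᵐᵒᵖ DC := H.pr.finite
  obtain ⟨P2, P1, P0, d2, d1, d0, f2, f1, f0, h⟩ := exists_res hgl DC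
  let q : (P2 →ₗ[Cᵐᵒᵖ] C) →ₗ[C] E :=
    { toFun := fun g => lam.symm (push DC (N' := CC C) g h.kap)
      map_add' := fun g g' => by
        rw [← map_add]
        exact congrArg lam.symm (push_add (N' := CC C) g g' h.kap)
      map_smul' := fun c g => by
        apply lam.injective
        rw [RingHom.id_apply, H.left, lam.apply_symm_apply, lam.apply_symm_apply, ← push_comp]
        rfl }
  refine ⟨P2, P1, P0, d2, d1, d0, q, f2, f1, h, ?_, ?_⟩
  · intro e
    obtain ⟨g, hg⟩ := h.kap_surj (lam e)
    exact ⟨g, lam.symm_apply_eq.2 hg⟩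
  · intro g
    refine Iff.trans ?_ (h.kap_zero (N := CC C) g)
    exact lam.symm.map_eq_zero_iff

theorem LamData.finE (H : LamData φ lam) (hgl : GlDimLE2 Cᵐᵒᵖ) : Module.Finite C E := by
  obtain ⟨P2, P1, P0, d2, d1, d0, q, f2, f1, h, hqs, hq⟩ := H.pres hgl
  have := h.p2
  have := finite_dual (A := C) P2
  exact Module.Finite.of_surjective q hqs

/-- decomposition of `Ext²` out of a power -/
theorem pull_pi {R : Type} [Ring R] {ι : Type} [Fintype ι] [DecidableEq ι] (D N : Mdl R)
    (η : E2 (ModuleCat.of R (ι → D)) N) :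
    η = ∑ j, pull (X := ModuleCat.of R (ι → D)) (Y := D) N (LinearMap.proj j)
      (pull (Y := ModuleCat.of R (ι → D)) N (LinearMap.single R (fun _ => D) j) η) := by
  have : (LinearMap.id : ModuleCat.of R (ι → D) →ₗ[R] ModuleCat.of R (ι → D)) =
      ∑ j, (LinearMap.single R (fun _ => D) j : D →ₗ[R] (ι → D)).comp
        (LinearMap.proj j : (ι → D) →ₗ[R] D) := by
    ext i x j
    simp [Finset.sum_apply, Pi.single_apply]
  conv_lhs => rw [← pull_id η, this]
  refine (pull_sum (X := ModuleCat.of R (ι → D)) (Y := ModuleCat.of R (ι → D)) _ _ η).trans ?_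
  refine Finset.sum_congr rfl fun j _ => ?_
  exact pull_comp (X := ModuleCat.of R (ι → D)) (Y := D) (Z := ModuleCat.of R (ι → D)) _ _ η

theorem tens_iff_IdLE1 (H : LamData φ lam) (hgl : GlDimLE2 Cᵐᵒᵖ) (M : Mdl Cᵐᵒᵖ) :
    TensZero C M E ↔ IdLE1 Cᵐᵒᵖ M := by
  obtain ⟨P2, P1, P0, d2, d1, d0, q, f2, f1, h, hqs, hq⟩ := H.pres hgl
  have := h.p2
  have := h.p1
  rw [tensZero_iff d2 q hqs hq]
  constructor
  · intro hz
    have hz' : ∀ x : E2 DC M, x = 0 := by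
      intro x
      obtain ⟨g, rfl⟩ := h.kap_surj x
      exact (h.kap_zero g).2 (hz g)
    refine IdLE1_of_E2 M fun J x => ?_
    obtain ⟨n, i, hi⟩ := H.pr.embed (Cᵐᵒᵖ ⧸ J)
    obtain ⟨η, rfl⟩ := pull_surj hgl (X := ModuleCat.of Cᵐᵒᵖ (Cᵐᵒᵖ ⧸ J))
      (Y := ModuleCat.of Cᵐᵒᵖ (Fin n → DC)) M i hi x
    rw [pull_pi DC M η]
    simp only [hz' (pull M _ η), map_zero, Finset.sum_const_zero]
  · intro hM g
    exact (h.kap_zero g).1 (E2_zero_of_IdLE1 hM DC _)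

end Lam
end RelExtProof

open CategoryTheory MulOpposite

namespace RelExtProof

section PdSide

variable {k : Type} [Field k] {C : Type} [Ring C] [Algebra k C]

theorem Pr.map_zero_right {N U : Type} [AddCommGroup N] [AddCommGroup U] [Module Cᵐᵒᵖ N]
    [Module C U] {φ : N → U → k} (h : Pr (C := C) φ) (n : N) : φ n 0 = 0 := by
  simpa using h.h2 n 0 0

theorem Pr.map_zero_left {N U : Type} [AddCommGroup N] [AddCommGroup U] [Module Cᵐᵒᵖ N]
    [Module C U] {φ : N → U → k} (h : Pr (C := C) φ) (u : U) : φ 0 u = 0 := by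
  simpa using h.h1 0 0 u

theorem Pr.map_sum_right {N U : Type} [AddCommGroup N] [AddCommGroup U] [Module Cᵐᵒᵖ N]
    [Module C U] {φ : N → U → k} (h : Pr (C := C) φ) (n : N) {ι : Type} (s : Finset ι)
    (u : ι → U) : φ n (∑ i ∈ s, u i) = ∑ i ∈ s, φ n (u i) :=
  map_sum (AddMonoidHom.mk' (φ n) (h.h2 n)) u s

theorem Pr.map_sum_left {N U : Type} [AddCommGroup N] [AddCommGroup U] [Module Cᵐᵒᵖ N]
    [Module C U] {φ : N → U → k} (h : Pr (C := C) φ) (u : U) {ι : Type} (s : Finset ι)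
    (n : ι → N) : φ (∑ i ∈ s, n i) u = ∑ i ∈ s, φ (n i) u :=
  map_sum (AddMonoidHom.mk' (φ · u) (fun a b => h.h1 a b u)) n s

variable [FiniteDimensional k C] {DC TC Tr : Type} [AddCommGroup DC] [AddCommGroup TC]
  [AddCommGroup Tr] [Module Cᵐᵒᵖ DC] [Module Cᵐᵒᵖ TC] [Module C Tr]
  {φ : DC → C → k} {ρ : TC → Tr → k}

theorem exists_ev (hφ : Pr (C := C) φ) (hρ : Pr (C := C) ρ) :
    ∃ ev : Tr → (TC →ₗ[Cᵐᵒᵖ] DC), ∀ x t c, φ (ev x t) c = ρ t (c • x) := by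
  have : ∀ x : Tr, ∃ u : TC →ₗ[Cᵐᵒᵖ] DC, ∀ t c, φ (u t) c = ρ t (c • x) := fun x => by
    refine hφ.lift (fun t c => ρ t (c • x)) ?_ ?_ ?_ ?_
    · intro n n' m; exact hρ.h1 _ _ _
    · intro n m m'; simp only [add_smul]; exact hρ.h2 _ _ _
    · intro c n m; simp only [smul_eq_mul, mul_smul]; exact hρ.h3 _ _ _
    · intro a n m; simp only [smul_eq_mul, mul_smul]; exact hρ.h4 _ _ _
  choose ev hev using this
  exact ⟨ev, hev⟩

theorem exists_mu (hφ : Pr (C := C) φ) :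
    ∃ mu : C → (DC →ₗ[Cᵐᵒᵖ] DC), ∀ c n x, φ (mu c n) x = φ n (x * c) := by
  have : ∀ c : C, ∃ u : DC →ₗ[Cᵐᵒᵖ] DC, ∀ n x, φ (u n) x = φ n (x * c) := fun c => by
    refine hφ.lift (fun n x => φ n (x * c)) ?_ ?_ ?_ ?_
    · intro n n' m; exact hφ.h1 _ _ _
    · intro n m m'; simp only [add_mul]; exact hφ.h2 _ _ _
    · intro c n m; simp only [smul_eq_mul, mul_assoc]; exact hφ.h3 _ _ _
    · intro a n m; simp only [smul_eq_mul, mul_assoc]; exact hφ.h4 _ _ _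
  choose ev hev using this
  exact ⟨ev, hev⟩

variable {ev : Tr → (TC →ₗ[Cᵐᵒᵖ] DC)} {mu : C → (DC →ₗ[Cᵐᵒᵖ] DC)}

theorem ev_add (hφ : Pr (C := C) φ) (hρ : Pr (C := C) ρ)
    (hev : ∀ x t c, φ (ev x t) c = ρ t (c • x)) (x y : Tr) : ev (x + y) = ev x + ev y := by
  ext t
  refine hφ.ext fun c => ?_
  rw [hev, LinearMap.add_apply, hφ.h1, hev, hev, smul_add, hρ.h2]

theorem ev_smul (hφ : Pr (C := C) φ) 
    (hev : ∀ x t c, φ (ev x t) c = ρ t (c • x)) (hmu : ∀ c n x, φ (mu c n) x = φ n (x * c))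
    (c : C) (x : Tr) : ev (c • x) = (mu c).comp (ev x) := by
  ext t
  refine hφ.ext fun m => ?_
  rw [hev, LinearMap.comp_apply, hmu, hev, mul_smul]

theorem ev_inj (hφ : Pr (C := C) φ) (hρ : Pr (C := C) ρ)
    (hev : ∀ x t c, φ (ev x t) c = ρ t (c • x)) {n : ℕ} (f : (Fin n → C) →ₗ[C] Tr)
    (hf : Function.Surjective f) :
    Function.Injective (LinearMap.pi fun j => ev (f (Pi.single j 1)) : TC →ₗ[Cᵐᵒᵖ] (Fin n → DC)) := by
  rw [injective_iff_map_eq_zero]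
  intro t ht
  refine hρ.h5 t fun u => ?_
  obtain ⟨w, rfl⟩ := hf u
  have hw : w = ∑ j, w j • Pi.single j (1 : C) := by
    ext l; simp [Finset.sum_apply, Pi.single_apply]
  rw [hw, map_sum, hρ.map_sum_right]
  refine Finset.sum_eq_zero fun j _ => ?_
  rw [map_smul, ← hev]
  have : ev (f (Pi.single j 1)) t = 0 := congrFun ht j
  rw [this, hφ.map_zero_left]

theorem ev_range (hφ : Pr (C := C) φ) (hρ : Pr (C := C) ρ) [Module.Finite C Tr]
    (hev : ∀ x t c, φ (ev x t) c = ρ t (c • x)) (hmu : ∀ c n x, φ (mu c n) x = φ n (x * c))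
    {n m : ℕ} (f : (Fin n → C) →ₗ[C] Tr)
    (hf : Function.Surjective f) (g : (Fin m → C) →ₗ[C] (Fin n → C))
    (hg : LinearMap.range g = LinearMap.ker f) :
    LinearMap.range (LinearMap.pi fun j => ev (f (Pi.single j 1)) : TC →ₗ[Cᵐᵒᵖ] (Fin n → DC)) =
    LinearMap.ker (LinearMap.pi fun i => ∑ l, (mu (g (Pi.single i 1) l)).comp (LinearMap.proj l) :
      (Fin n → DC) →ₗ[Cᵐᵒᵖ] (Fin m → DC)) := by
  have hw : ∀ {n : ℕ} (w : Fin n → C), w = ∑ j, w j • Pi.single j (1 : C) := by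
    intro n w; ext l; simp [Finset.sum_apply, Pi.single_apply]
  have hA : ∀ (v : Fin n → DC) i c, φ ((∑ l, (mu (g (Pi.single i 1) l)).comp
      (LinearMap.proj l : (Fin n → DC) →ₗ[Cᵐᵒᵖ] DC)) v) c =
      ∑ l, φ (v l) (c * g (Pi.single i 1) l) := by
    intro v i c
    rw [LinearMap.sum_apply, hφ.map_sum_left]
    refine Finset.sum_congr rfl fun l _ => ?_
    rw [LinearMap.comp_apply, hmu]; rfl
  apply le_antisymm
  · rintro _ ⟨t, rfl⟩
    rw [LinearMap.mem_ker]
    ext i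
    refine hφ.ext fun c => ?_
    rw [LinearMap.pi_apply, hA, Pi.zero_apply, hφ.map_zero_left]
    simp only [LinearMap.pi_apply, hev, ← hρ.map_sum_right]
    have : f (g (Pi.single i 1)) = 0 := by
      have : g (Pi.single i 1) ∈ LinearMap.ker f := hg ▸ ⟨_, rfl⟩
      exact this
    rw [hw (g (Pi.single i 1)), map_sum] at this
    simp only [mul_smul, ← Finset.smul_sum]
    simp only [map_smul] at this
    rw [this, smul_zero, hρ.map_zero_right]
  · intro v hv
    let F : (Fin n → C) → k := fun w => ∑ l, φ (v l) (w l)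
    have Fadd : ∀ w w', F (w + w') = F w + F w' := fun w w' => by
      simp only [F, Pi.add_apply, hφ.h2, Finset.sum_add_distrib]
    let F' : (Fin n → C) →+ k := AddMonoidHom.mk' F Fadd
    have Fsm : ∀ (c : k) w, F (algebraMap k C c • w) = c * F w := fun c w => by
      simp only [F, Pi.smul_apply, hφ.h3, Finset.mul_sum]
    have Fk : ∀ w, f w = 0 → F w = 0 := by
      intro w h0
      have : w ∈ LinearMap.range g := hg ▸ h0
      obtain ⟨c, rfl⟩ := this
      conv_lhs => rw [hw c, map_sum]
      refine (map_sum F' _ _).trans (Finset.sum_eq_zero fun i _ => ?_)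
      have h1 : (∑ l, (mu (g (Pi.single i 1) l)).comp
        (LinearMap.proj l : (Fin n → DC) →ₗ[Cᵐᵒᵖ] DC)) v = 0 := congrFun hv i
      have := hA v i (c i)
      rw [h1, hφ.map_zero_left] at this
      rw [map_smul]
      exact this.symm
    have Fk' : ∀ w w', f w = f w' → F w = F w' := by
      intro w w' h0
      have := Fk (w - w') (by rw [map_sub, h0, sub_self])
      exact sub_eq_zero.1 ((map_sub F' w w').symm.trans this)
    have hs := Function.surjInv_eq hf
    obtain ⟨t, ht⟩ := hρ.surj (fun u => F (Function.surjInv hf u))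
      (fun x y => by rw [← Fadd]; exact Fk' _ _ (by rw [map_add, hs, hs, hs]))
      (fun c x => by rw [← Fsm]; exact Fk' _ _ (by rw [map_smul, hs, hs]))
    refine ⟨t, ?_⟩
    ext l
    refine hφ.ext fun c => ?_
    rw [LinearMap.pi_apply, hev, ← map_smul, ht, Fk' _ _ (hs _)]
    show ∑ i, _ = _
    rw [Finset.sum_eq_single l]
    · simp
    · intro i _ hi
      simp [Pi.single_eq_of_ne hi, hφ.map_zero_right]
    · simp

end PdSide

section PdSide2

variable {k : Type} [Field k] {C : Type} [Ring C] [Algebra k C] [FiniteDimensional k C]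
  {E : Type} [AddCommGroup E] [Module C E] [Module Cᵐᵒᵖ E]
  {DC : Mdl Cᵐᵒᵖ} {φ : DC → C → k} {lam : E ≃+ E2 DC (CC C)}

/-- coordinates of an `Ext²` class on a power of `DC` -/
theorem lam_coord {n : ℕ} (lam : E ≃+ E2 DC (CC C))
    (η : E2 (ModuleCat.of Cᵐᵒᵖ (Fin n → DC)) (CC C)) : ∃ e : Fin n → E,
    η = ∑ j, pull (X := ModuleCat.of Cᵐᵒᵖ (Fin n → DC)) (Y := DC) (CC C) (LinearMap.proj j)
      (lam (e j)) := by
  refine ⟨fun j => lam.symm (pull (Y := ModuleCat.of Cᵐᵒᵖ (Fin n → DC)) (CC C)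
    (LinearMap.single Cᵐᵒᵖ (fun _ => DC) j) η), ?_⟩
  simp only [lam.apply_symm_apply]
  exact pull_pi DC (CC C) η

theorem E2_op {X : Mdl Cᵐᵒᵖ} (h : ∀ x : E2 X (CC C), x = 0)
    (x : E2 X (ModuleCat.of Cᵐᵒᵖ Cᵐᵒᵖ)) : x = 0 := by
  let f : CC C →ₗ[Cᵐᵒᵖ] ModuleCat.of Cᵐᵒᵖ Cᵐᵒᵖ :=
    { toFun := fun c => op (c : C), map_add' := fun _ _ => rfl, map_smul' := fun _ _ => rfl }
  let g : ModuleCat.of Cᵐᵒᵖ Cᵐᵒᵖ →ₗ[Cᵐᵒᵖ] CC C :=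
    { toFun := fun c => (unop (c : Cᵐᵒᵖ) : C), map_add' := fun _ _ => rfl,
      map_smul' := fun _ _ => rfl }
  have : f.comp g = LinearMap.id := rfl
  rw [← push_id x, ← this, push_comp, h (push X g x), map_zero]

theorem tens_iff_PdLE1 (H : LamData φ lam) (hgl : GlDimLE2 Cᵐᵒᵖ) (TC : Mdl Cᵐᵒᵖ)
    (Tr : Mdl C) [Module.Finite C Tr] (ρ : TC → Tr → k) (hρ : Pr (C := C) ρ) :
    TensZero C E Tr ↔ PdLE1 Cᵐᵒᵖ TC := by
  have hφ := H.pr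
  have := noeth k C
  have : IsNoetherianRing C := IsNoetherianRing.of_finite k C
  obtain ⟨ev, hev⟩ := exists_ev hφ hρ
  obtain ⟨mu, hmu⟩ := exists_mu hφ
  obtain ⟨n, f, hf⟩ := Module.Finite.exists_fin' C Tr
  have hw : ∀ {n : ℕ} (w : Fin n → C), w = ∑ j, w j • Pi.single j (1 : C) := by
    intro n w; ext l; simp [Finset.sum_apply, Pi.single_apply]
  let i : TC →ₗ[Cᵐᵒᵖ] ModuleCat.of Cᵐᵒᵖ (Fin n → DC) :=
    LinearMap.pi fun j => ev (f (Pi.single j 1))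
  have hi : Function.Injective i := ev_inj hφ hρ hev f hf
  have pi_i : ∀ j x, pull (CC C) i (pull (X := ModuleCat.of Cᵐᵒᵖ (Fin n → DC)) (Y := DC) (CC C)
      (LinearMap.proj j) x) = pull (CC C) (ev (f (Pi.single j 1))) x := fun j x =>
    (pull_comp (Y := ModuleCat.of Cᵐᵒᵖ (Fin n → DC)) _ _ x).symm
  constructor
  · intro hT
    let ψ : E →+ Tr →+ E2 TC (CC C) := AddMonoidHom.mk' (fun e =>
      AddMonoidHom.mk' (fun x => pull (CC C) (ev x) (lam e)) fun x y => by
        rw [ev_add hφ hρ hev, pull_add]) fun e e' => by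
        ext x
        show pull (CC C) (ev x) (lam (e + e')) = pull (CC C) (ev x) (lam e) +
          pull (CC C) (ev x) (lam e')
        rw [map_add, map_add]
    have hz := hT _ ψ (fun c e x => by
      show pull (CC C) (ev x) (lam (op c • e)) = pull (CC C) (ev (c • x)) (lam e)
      rw [H.right c (mu c) (hmu c), ev_smul hφ hev hmu, pull_comp])
    have : Module.Finite Cᵐᵒᵖ TC := hρ.finite
    refine PdLE1_of_E2 hgl TC (E2_op fun x => ?_)
    obtain ⟨η, rfl⟩ := pull_surj hgl (CC C) i hi x
    obtain ⟨e, rfl⟩ := lam_coord lam η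
    rw [map_sum]
    refine Finset.sum_eq_zero fun j _ => ?_
    rw [pi_i]
    exact hz (e j) _
  · intro hP Y _ ψ hψ
    obtain ⟨m, g0, hg0⟩ := Module.Finite.exists_fin' C (LinearMap.ker f)
    let g : (Fin m → C) →ₗ[C] (Fin n → C) := (LinearMap.ker f).subtype.comp g0
    have hg : LinearMap.range g = LinearMap.ker f := by
      rw [LinearMap.range_comp, LinearMap.range_eq_top.2 hg0, Submodule.map_top,
        Submodule.range_subtype]
    have hr := ev_range hφ hρ hev hmu f hf g hg
    let Ai : Fin m → ((Fin n → DC) →ₗ[Cᵐᵒᵖ] DC) := fun i =>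
      ∑ l, (mu (g (Pi.single i 1) l)).comp (LinearMap.proj l)
    let A : ModuleCat.of Cᵐᵒᵖ (Fin n → DC) →ₗ[Cᵐᵒᵖ] ModuleCat.of Cᵐᵒᵖ (Fin m → DC) :=
      LinearMap.pi Ai
    have key : ∀ e j, ∃ e' : Fin m → E, ∀ l, ∑ i, op (g (Pi.single i 1) l) • e' i =
        if l = j then e else 0 := by
      intro e j
      obtain ⟨y, hy⟩ := pull_exact (Z := ModuleCat.of Cᵐᵒᵖ (LinearMap.range A)) i A.rangeRestrict
        (by rw [LinearMap.ker_rangeRestrict]; exact hr) hi A.surjective_rangeRestrict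
        (pull (X := ModuleCat.of Cᵐᵒᵖ (Fin n → DC)) (Y := DC) (CC C)
          (LinearMap.proj j) (lam e)) (E2_zero_of_PdLE1 hP _ _)
      obtain ⟨η, rfl⟩ := pull_surj hgl (X := ModuleCat.of Cᵐᵒᵖ (LinearMap.range A)) (CC C)
        (LinearMap.range A).subtype (Submodule.injective_subtype _) y
      obtain ⟨e', rfl⟩ := lam_coord lam η
      refine ⟨e', fun l => lam.injective ?_⟩
      rw [← pull_comp (Y := ModuleCat.of Cᵐᵒᵖ (LinearMap.range A)) , map_sum] at hy
      have hy' := congrArg (pull (Y := ModuleCat.of Cᵐᵒᵖ (Fin n → DC)) (CC C)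
        (LinearMap.single Cᵐᵒᵖ (fun _ => DC) l)) hy
      rw [map_sum] at hy'
      rw [map_sum]
      refine Eq.trans ?_ (hy'.trans ?_)
      · refine Finset.sum_congr rfl fun i _ => ?_
        rw [H.right _ _ (hmu _)]
        rw [← pull_comp (Y := ModuleCat.of Cᵐᵒᵖ (Fin m → DC)),
          ← pull_comp (Y := ModuleCat.of Cᵐᵒᵖ (Fin n → DC))]
        congr 2
        ext x
        show _ = Ai i (Pi.single l x)
        simp only [Ai, LinearMap.sum_apply, LinearMap.comp_apply, LinearMap.proj_apply]
        rw [Finset.sum_eq_single l]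
        · simp
        · intro b _ hb; simp [Pi.single_eq_of_ne hb]
        · simp
      · rw [← pull_comp (Y := ModuleCat.of Cᵐᵒᵖ (Fin n → DC))]
        split_ifs with hl
        · subst hl
          have : (LinearMap.proj l : (Fin n → DC) →ₗ[Cᵐᵒᵖ] DC).comp
            (LinearMap.single Cᵐᵒᵖ (fun _ => DC) l) = LinearMap.id := by ext x; simp
          exact (congrArg (fun u => pull (CC C) u (lam e)) this).trans (pull_id _)
        · have : (LinearMap.proj j : (Fin n → DC) →ₗ[Cᵐᵒᵖ] DC).comp
            (LinearMap.single Cᵐᵒᵖ (fun _ => DC) l) = 0 := by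
            ext x; simp [Pi.single_eq_of_ne (Ne.symm hl)]
          rw [map_zero]
          exact (congrArg (fun u => pull (CC C) u (lam e)) this).trans (pull_zero _)
    have hx : ∀ e j, ψ e (f (Pi.single j 1)) = 0 := by
      intro e j
      obtain ⟨e', he'⟩ := key e j
      have h1 : ψ e (f (Pi.single j 1)) = ∑ l, ψ (∑ i, op (g (Pi.single i 1) l) • e' i)
          (f (Pi.single l 1)) := by
        rw [Finset.sum_eq_single j]
        · rw [he', if_pos rfl]
        · intro l _ hl
          rw [he', if_neg hl, map_zero, AddMonoidHom.zero_apply]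
        · simp
      rw [h1]
      simp only [map_sum, AddMonoidHom.finsetSum_apply, hψ]
      rw [Finset.sum_comm]
      refine Finset.sum_eq_zero fun i _ => ?_
      rw [← map_sum]
      have : f (g (Pi.single i 1)) = 0 := (g0 (Pi.single i 1)).2
      rw [hw (g (Pi.single i 1)), map_sum] at this
      simp only [map_smul] at this
      rw [this, map_zero]
    intro e u
    obtain ⟨w, rfl⟩ := hf u
    rw [hw w, map_sum, map_sum]
    refine Finset.sum_eq_zero fun j _ => ?_
    rw [map_smul, ← hψ, hx]

end PdSide2
end RelExtProof


open RelExtProof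

/-- For `C` of global dimension 2 and `B = C ⋉ Ext²(DC, C)`:
`τ_C M ≅ τ_B M` (as `B`-modules) iff `pd_C (τ_C M) ≤ 1` and `id_C M ≤ 1`. -/
theorem tauC_eq_tauB_iff
    (k : Type) [Field k] (C : Type) [Ring C] [Algebra k C] [FiniteDimensional k C]
    (E : Type) [AddCommGroup E] [Module C E] [Module Cᵐᵒᵖ E] [SMulCommClass C Cᵐᵒᵖ E]
    [Module k E] [IsScalarTower k C E] [IsScalarTower k Cᵐᵒᵖ E]
    (hgl : GlDimEq2 Cᵐᵒᵖ) (hE : IsRelExt k C E)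
    (M : Mdl Cᵐᵒᵖ) [Module.Finite Cᵐᵒᵖ M]
    (TC : Mdl Cᵐᵒᵖ) (TB : Mdl (TrivSqZeroExt C E)ᵐᵒᵖ)
    (hTC : IsTau k C M TC)
    (hTB : IsTau k (TrivSqZeroExt C E) (modB C E M) TB) :
    Nonempty (modB C E TC ≃ₗ[(TrivSqZeroExt C E)ᵐᵒᵖ] TB) ↔
      (PdLE1 Cᵐᵒᵖ TC ∧ IdLE1 Cᵐᵒᵖ M) := by
  obtain ⟨DC, φ, lam, H⟩ := exists_lam hE
  have fE : Module.Finite C E := H.finE hgl.1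
  have fkE : FiniteDimensional k E := Module.Finite.trans C E
  have fB : FiniteDimensional k (TrivSqZeroExt C E) :=
    inferInstanceAs (FiniteDimensional k (C × E))
  have nC := noeth k C
  have nB := noeth k (TrivSqZeroExt C E)
  obtain ⟨P1, P0, d1, d0, ⟨⟨p0, s0, m0⟩, p1, ex, m1⟩, TrC, r, hrs, hr, hC⟩ := hTC
  obtain ⟨Q1, Q0, D1, D0', ⟨⟨q0, S0, M0⟩, q1, EX, M1⟩, TrB, q, hqs, hq, hB⟩ := hTB
  let D0 : Q0 →ₛₗ[piO C E] M :=
    { toFun := fun x => D0' x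
      map_add' := fun x y => map_add D0' x y
      map_smul' := fun b x => map_smul D0' b x }
  have hD0 : Function.Surjective D0 := S0
  have hkD : LinearMap.ker D0 = LinearMap.ker D0' := rfl
  have fP0 : Module.Finite Cᵐᵒᵖ P0 :=
    finite_of_cover d0 ⊤ Module.Finite.fg_top (LinearMap.range_eq_top.2 s0) m0
  have fP1 : Module.Finite Cᵐᵒᵖ P1 :=
    finite_of_cover d1 _ (IsNoetherian.noetherian _) rfl m1
  have fQ0 : Module.Finite (TrivSqZeroExt C E)ᵐᵒᵖ Q0 :=
    finite_of_cover D0 ⊤ Module.Finite.fg_top (LinearMap.range_eq_top.2 hD0) M0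
  have fQ1 : Module.Finite (TrivSqZeroExt C E)ᵐᵒᵖ Q1 :=
    finite_of_cover D1 _ (IsNoetherian.noetherian _) rfl M1
  obtain ⟨c⟩ := exists_cmp (d1 := d1) (d0 := d0) (D1 := D1) (D0 := D0) s0 hD0 ex EX m0 m1 M0
  have fTr : Module.Finite C TrC := by
    have := finite_dual (A := C) P1
    exact Module.Finite.of_surjective r hrs
  obtain ⟨ρ, b1, b2, b3, b4, b5, b6⟩ := id hC
  rw [← tens_iff_PdLE1 H hgl.1 TC TrC ρ ⟨b1, b2, b3, b4, b5, b6⟩, ← tens_iff_IdLE1 H hgl.1 M,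
    tensZero_iff d1 r hrs hr, tens_iff hD0]
  constructor
  · rintro ⟨e⟩
    exact (c.forward q hqs hq r hrs hr hC hB (TC := TC) (TB := TB) e.toAddEquiv
      (fun b t => e.map_smul (op b) t)).symm
  · rintro ⟨hX, hT⟩
    obtain ⟨e, he⟩ := c.backward M1 q hqs hq r hrs hr hC hB hT hX
    exact ⟨{ e with
      map_smul' := fun b t => he b.unop t }⟩
end

section
/- Let C be an algebra of global dimension 2 and B = C ⋉ Ext^2_C(DC,C). If M is a τ_C-rigid C-module with id_C M ≤ 1, then M is τ_B-rigid. -/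
open CategoryTheory MulOpposite

open CategoryTheory MulOpposite

section Helpers

lemma ext_of_idLE1 {R : Type} [Ring R] {M P2 P1 P0 : Mdl R} (hid : IdLE1 R M)
    (d2 : P2 →ₗ[R] P1) (d1 : P1 →ₗ[R] P0) (hP0 : Module.Projective R P0)
    (hd2 : Function.Injective d2) (hex : LinearMap.range d2 = LinearMap.ker d1)
    (α : P2 →ₗ[R] M) : ∃ f : P1 →ₗ[R] M, f.comp d2 = α := by
  obtain ⟨I0, I1, j0, j1, hI0, hI1, hj0, hj1, hj⟩ := hid
  obtain ⟨a, ha⟩ := hI0.out d2 hd2 (j0.comp α)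
  have hk : LinearMap.ker d1 ≤ LinearMap.ker (j1.comp a) := by
    rw [← hex]
    rintro _ ⟨x, rfl⟩
    have : j0 (α x) ∈ LinearMap.ker j1 := hj ▸ ⟨_, rfl⟩
    simpa [ha] using this
  obtain ⟨b, hb⟩ := hI1.out ((LinearMap.ker d1).liftQ d1 le_rfl)
    (LinearMap.ker_eq_bot.1 (Submodule.ker_liftQ_eq_bot _ _ _ le_rfl))
    ((LinearMap.ker d1).liftQ (j1.comp a) hk)
  have hb' : ∀ x, b (d1 x) = j1 (a x) := fun x => by
    simpa using hb (Submodule.Quotient.mk x)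
  obtain ⟨b', hb''⟩ := Module.projective_lifting_property j1 b hj1
  have hr : ∀ x, (a - b'.comp d1) x ∈ LinearMap.range j0 := by
    intro x
    rw [hj, LinearMap.mem_ker, LinearMap.sub_apply, map_sub, ← hb', LinearMap.comp_apply,
      ← hb'', LinearMap.comp_apply, sub_self]
  refine ⟨(LinearEquiv.ofInjective j0 hj0).symm.toLinearMap.comp
    ((a - b'.comp d1).codRestrict _ hr), ?_⟩
  ext x
  apply hj0
  have h1 : ∀ y, j0 ((LinearEquiv.ofInjective j0 hj0).symm y) = y := fun y => by
    have := LinearEquiv.apply_symm_apply (LinearEquiv.ofInjective j0 hj0) y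
    exact congrArg Subtype.val this
  have h2 : d1 (d2 x) = 0 := by
    have : d2 x ∈ LinearMap.ker d1 := hex ▸ ⟨_, rfl⟩
    exact this
  simp [h1, h2]
  simpa using ha x

/-- unop as a right-linear map. -/
def unopR (A : Type) [Ring A] : Aᵐᵒᵖ →ₗ[Aᵐᵒᵖ] A where
  toFun := unop
  map_add' _ _ := rfl
  map_smul' _ _ := rfl

/-- `c ↦ m c` -/
def actR {A : Type} [Ring A] {P M : Mdl Aᵐᵒᵖ} (g : P →ₗ[Aᵐᵒᵖ] A) (m : M) : P →ₗ[Aᵐᵒᵖ] M where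
  toFun p := op (g p) • m
  map_add' _ _ := by simp [add_smul]
  map_smul' c p := by
    induction c using MulOpposite.rec'
    simp [mul_smul]

lemma tensor_zero (k : Type) [Field k] (C : Type) [Ring C] [Algebra k C] [FiniteDimensional k C]
    (E : Type) [AddCommGroup E] [Module C E] [Module Cᵐᵒᵖ E]
    (hE : IsRelExt k C E) (M : Mdl Cᵐᵒᵖ) [Module.Finite Cᵐᵒᵖ M] (hid : IdLE1 Cᵐᵒᵖ M)
    (A : Type) [AddCommGroup A] (β : M →+ E →+ A)
    (hβ : ∀ (c : C) m e, β (op c • m) e = β m (c • e)) (m : M) (e : E) : β m e = 0 := by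
  obtain ⟨DC, φ, -, -, -, -, -, -, P2, P1, P0, d2, d1, d0, hP2, hP1, hP0, hd2, -, hex, -, q, hq,
    hqk, -⟩ := hE
  have : IsNoetherianRing Cᵐᵒᵖ := IsNoetherianRing.of_finite k Cᵐᵒᵖ
  obtain ⟨n, π, hπ⟩ := Module.Finite.exists_fin' Cᵐᵒᵖ M
  obtain ⟨r, ϖ, hϖ⟩ := Module.Finite.exists_fin' Cᵐᵒᵖ (LinearMap.ker π)
  obtain ⟨g, rfl⟩ := hq e
  obtain ⟨x, rfl⟩ := hπ m
  obtain ⟨f, hf⟩ := ext_of_idLE1 hid d2 d1 hP0 hd2 hex (actR g (π x))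
  obtain ⟨F, hF⟩ := Module.projective_lifting_property π f hπ
  let X : P2 →ₗ[Cᵐᵒᵖ] (Fin n → Cᵐᵒᵖ) := actR (M := ModuleCat.of Cᵐᵒᵖ (Fin n → Cᵐᵒᵖ)) g x
  have hX : ∀ p, X p = op (g p) • x := fun _ => rfl
  have hmem : ∀ p, (F.comp d2 - X) p ∈ LinearMap.ker π := by
    intro p
    have h1 : π (F (d2 p)) = f (d2 p) := by rw [← hF]; rfl
    have h2 : f (d2 p) = op (g p) • π x := LinearMap.congr_fun hf p
    simp [hX, h1, h2]
  obtain ⟨L, hL⟩ := Module.projective_lifting_property ϖ ((F.comp d2 - X).codRestrict _ hmem) hϖ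
  let y : Fin r → (Fin n → Cᵐᵒᵖ) := fun j => (ϖ (Pi.single j 1) : Fin n → Cᵐᵒᵖ)
  have hLy : ∀ p, F (d2 p) - op (g p) • x = ∑ j, L p j • y j := by
    intro p
    have h1 := congrArg Subtype.val (LinearMap.congr_fun hL p)
    have h2 : L p = ∑ j, L p j • (Pi.single j (1 : Cᵐᵒᵖ) : Fin r → Cᵐᵒᵖ) := by
      ext i; simp [Finset.sum_apply, Pi.single_apply]
    rw [LinearMap.comp_apply, h2, map_sum] at h1
    simp only [map_smul] at h1
    simpa [hX] using h1.symm
  let l : Fin r → (P2 →ₗ[Cᵐᵒᵖ] C) := fun j => (unopR C).comp ((LinearMap.proj j).comp L)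
  have key : ∀ i, unop (x i) • q g = - ∑ j, unop (y j i) • q (l j) := by
    intro i
    have h0 : q (((unopR C).comp ((LinearMap.proj i).comp F)).comp d2) = 0 := (hqk _).2 ⟨_, rfl⟩
    have h1 : ((unopR C).comp ((LinearMap.proj i).comp F)).comp d2
        = unop (x i) • g + ∑ j, unop (y j i) • l j := by
      ext p
      have := congrArg unop (congrFun (hLy p) i)
      simp [Finset.sum_apply] at this
      simp [l, unopR, ← this]
    rw [h1, map_add, map_sum] at h0
    simp only [map_smul] at h0
    exact eq_neg_of_add_eq_zero_left h0
  have hexp : ∀ z : Fin n → Cᵐᵒᵖ, ∀ e, β (π z) e = ∑ i, β (π (Pi.single i 1)) (unop (z i) • e) := by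
    intro z e
    have h2 : z = ∑ j, z j • (Pi.single j (1 : Cᵐᵒᵖ) : Fin n → Cᵐᵒᵖ) := by
      ext i; simp [Finset.sum_apply, Pi.single_apply]
    conv_lhs => rw [h2]
    rw [map_sum, map_sum, AddMonoidHom.finsetSum_apply]
    refine Finset.sum_congr rfl fun i _ => ?_
    rw [map_smul, ← hβ, op_unop]
  rw [hexp]
  simp only [key, map_neg, map_sum, Finset.sum_neg_distrib]
  rw [Finset.sum_comm, neg_eq_zero]
  refine Finset.sum_eq_zero fun j _ => ?_
  rw [← hexp]
  have : π (y j) = 0 := (ϖ (Pi.single j 1)).2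
  simp [this]

lemma exists_dual (k : Type) [Field k] (C : Type) [Ring C] [Algebra k C] (X : Mdl C) :
    ∃ (T : Mdl Cᵐᵒᵖ), IskDual k C T X ∧ ∀ (M : Mdl Cᵐᵒᵖ) (ψ : M → X → k),
      (∀ n n' m, ψ (n + n') m = ψ n m + ψ n' m) →
      (∀ n m m', ψ n (m + m') = ψ n m + ψ n m') →
      (∀ (c : k) n m, ψ n ((algebraMap k C c) • m) = c * ψ n m) →
      (∀ (a : C) n m, ψ (op a • n) m = ψ n (a • m)) →
      (∀ h : M →ₗ[Cᵐᵒᵖ] T, h = 0) → ∀ m x, ψ m x = 0 := by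
  let _ : Module k X := Module.compHom X (algebraMap k C)
  have hk : ∀ (c : k) (x : X), c • x = algebraMap k C c • x := fun _ _ => rfl
  let act : Module Cᵐᵒᵖ (Module.Dual k X) :=
    { smul := fun c t =>
        { toFun := fun x => t (unop c • x)
          map_add' := fun _ _ => by simp
          map_smul' := fun a x => by
            rw [hk, ← mul_smul, ← Algebra.commutes, mul_smul, ← hk, map_smul]; rfl }
      one_smul := fun t => by ext x; change t ((1 : C) • x) = t x; simp
      mul_smul := fun a b t => by
        ext x
        change t ((unop b * unop a) • x) = t (unop b • unop a • x)
        rw [mul_smul]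
      smul_zero := fun a => rfl
      zero_smul := fun t => by ext x; change t ((0 : C) • x) = 0; simp
      smul_add := fun _ _ _ => rfl
      add_smul := fun a b t => by
        ext x
        change t ((unop a + unop b) • x) = t (unop a • x) + t (unop b • x)
        rw [add_smul, map_add] }
  refine ⟨ModuleCat.of Cᵐᵒᵖ (Module.Dual k X), ⟨fun (t : Module.Dual k X) x => t x, ?_, ?_, ?_, ?_, ?_, ?_⟩, ?_⟩
  · intros; rfl
  · intros; exact map_add _ _ _
  · intro c n m; exact map_smul (n : Module.Dual k X) c m
  · intros; rfl
  · intro n h; exact LinearMap.ext h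
  · intro m h; exact (Module.forall_dual_apply_eq_zero_iff k m).1 h
  · intro M ψ h1 h2 h3 h4 h0 m x
    let h : M →ₗ[Cᵐᵒᵖ] Module.Dual k X :=
      { toFun := fun m => { toFun := ψ m, map_add' := h2 m, map_smul' := fun c x => h3 c m x }
        map_add' := fun a b => LinearMap.ext fun x => h1 a b x
        map_smul' := fun a b => LinearMap.ext fun x => h4 (unop a) b x }
    exact LinearMap.congr_fun (LinearMap.congr_fun (h0 h) m) x

section Push

variable {R S : Type} [Ring R] [Ring S] (σ : R →+* S)

lemma semilift {P X N : Type} [AddCommGroup P] [Module R P] [AddCommGroup X] [Module R X]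
    [AddCommGroup N] [Module S N] [Module.Projective R P]
    (π : X →ₛₗ[σ] N) (hπ : Function.Surjective π) (ψ : P →ₛₗ[σ] N) :
    ∃ L : P →ₗ[R] X, ∀ p, π (L p) = ψ p := by
  let _ : Module R N := Module.compHom N σ
  let π' : X →ₗ[R] N :=
    { toFun := π, map_add' := map_add π, map_smul' := fun r x => map_smulₛₗ π r x }
  let ψ' : P →ₗ[R] N :=
    { toFun := ψ, map_add' := map_add ψ, map_smul' := fun r x => map_smulₛₗ ψ r x }
  obtain ⟨L, hL⟩ := Module.projective_lifting_property π' ψ' hπ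
  exact ⟨L, fun p => LinearMap.congr_fun hL p⟩

lemma semilift' {P X N : Type} [AddCommGroup P] [Module R P] [AddCommGroup X] [Module S X]
    [AddCommGroup N] [Module S N] [Module.Projective R P]
    (π : X →ₗ[S] N) (hπ : Function.Surjective π) (ψ : P →ₛₗ[σ] N) :
    ∃ L : P →ₛₗ[σ] X, ∀ p, π (L p) = ψ p := by
  let _ : Module R X := Module.compHom X σ
  let π' : X →ₛₗ[σ] N :=
    { toFun := π, map_add' := map_add π, map_smul' := fun r x => map_smul π (σ r) x }
  obtain ⟨L, hL⟩ := semilift σ π' hπ ψ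
  exact ⟨{ toFun := L, map_add' := map_add L, map_smul' := fun r x => map_smul L r x }, hL⟩

lemma descend (hσ : Function.Surjective σ) {P Q N : Type} [AddCommGroup P] [Module R P]
    [AddCommGroup Q] [Module S Q] [AddCommGroup N] [Module S N]
    (ρ : P →ₛₗ[σ] Q) (hρ : Function.Surjective ρ)
    (hk : ∀ p, ρ p = 0 → p ∈ RingHom.ker σ • (⊤ : Submodule R P))
    (ψ : P →ₛₗ[σ] N) : ∃ f : Q →ₗ[S] N, ∀ p, f (ρ p) = ψ p := by
  have h0 : ∀ p, ρ p = 0 → ψ p = 0 := by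
    intro p hp
    have : RingHom.ker σ • (⊤ : Submodule R P) ≤ LinearMap.ker ψ := by
      rw [Submodule.smul_le]
      intro r hr n _
      rw [LinearMap.mem_ker, map_smulₛₗ, (RingHom.mem_ker).1 hr, zero_smul]
    exact this (hk p hp)
  have h1 : ∀ p p', ρ p = ρ p' → ψ p = ψ p' := by
    intro p p' h
    rw [← sub_eq_zero, ← map_sub]
    exact h0 _ (by rw [map_sub, h, sub_self])
  choose t ht using hρ
  refine ⟨{ toFun := fun x => ψ (t x), map_add' := ?_, map_smul' := ?_ }, ?_⟩
  · intro x y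
    rw [← map_add]
    exact h1 _ _ (by rw [map_add, ht, ht, ht])
  · intro c x
    obtain ⟨r, rfl⟩ := hσ c
    rw [RingHom.id_apply, ← map_smulₛₗ]
    exact h1 _ _ (by rw [map_smulₛₗ, ht, ht])
  · intro p
    exact h1 _ _ (ht _)

lemma pushdown_aux (s : S →+* R) (hs : ∀ x, σ (s x) = x) (P : Mdl R)
    (V : Type) [AddCommGroup V] [Module R V] (κ : P →ₗ[R] V) (hκ : Function.Surjective κ)
    (hker : ∀ p, κ p = 0 ↔ p ∈ RingHom.ker σ • (⊤ : Submodule R P)) :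
    ∃ (Q : Mdl S) (ρ : P →ₛₗ[σ] Q), Function.Surjective ρ ∧
      (∀ p, ρ p = 0 ↔ p ∈ RingHom.ker σ • (⊤ : Submodule R P)) ∧
      (Module.Projective R P → Module.Projective S Q) := by
  have hσ : Function.Surjective σ := fun x => ⟨s x, hs x⟩
  let mS : Module S V := Module.compHom V s
  let ρ : P →ₛₗ[σ] V :=
    { toFun := fun p => κ p
      map_add' := fun _ _ => map_add κ _ _
      map_smul' := fun r p => by
        change κ (r • p) = s (σ r) • κ p
        rw [← map_smul, ← sub_eq_zero, ← map_sub, hker, ← sub_smul]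
        exact Submodule.smul_mem_smul (by simp [RingHom.mem_ker, hs]) trivial }
  have hρ : Function.Surjective ρ := hκ
  have hk : ∀ p, ρ p = 0 ↔ p ∈ RingHom.ker σ • (⊤ : Submodule R P) := hker
  refine ⟨ModuleCat.of S V, ρ, hρ, hk, fun hP => ?_⟩
  change Module.Projective S V
  refine Module.Projective.of_lifting_property ?_
  intro X N _ _ _ _ f g hf
  obtain ⟨L, hL⟩ := semilift' σ f hf (g.comp ρ)
  obtain ⟨h, hh⟩ := descend σ hσ ρ hρ (fun p => (hk p).1) L
  refine ⟨h, ?_⟩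
  ext x
  obtain ⟨p, rfl⟩ := hρ x
  rw [LinearMap.comp_apply, hh, hL]; rfl

lemma pushdown (s : S →+* R) (hs : ∀ x, σ (s x) = x) (P : Mdl R) :
    ∃ (Q : Mdl S) (ρ : P →ₛₗ[σ] Q), Function.Surjective ρ ∧
      (∀ p, ρ p = 0 ↔ p ∈ RingHom.ker σ • (⊤ : Submodule R P)) ∧
      (Module.Projective R P → Module.Projective S Q) :=
  pushdown_aux σ s hs P _ (RingHom.ker σ • (⊤ : Submodule R P)).mkQ
    (Submodule.mkQ_surjective _) (fun _ => Submodule.Quotient.mk_eq_zero _)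

end Push

section Main

variable (k : Type) [Field k] (C : Type) [Ring C] [Algebra k C] [FiniteDimensional k C]
    (E : Type) [AddCommGroup E] [Module C E] [Module Cᵐᵒᵖ E] [SMulCommClass C Cᵐᵒᵖ E]

/-- The projection on opposite rings. -/
abbrev sig : (TrivSqZeroExt C E)ᵐᵒᵖ →+* Cᵐᵒᵖ := RingHom.op (tszeFst C E)

lemma sig_surj : Function.Surjective (sig C E) := fun x => ⟨op (TrivSqZeroExt.inl (unop x)), rfl⟩

instance : RingHomSurjective (sig C E) := ⟨sig_surj C E⟩

lemma mem_ker_sig {r : (TrivSqZeroExt C E)ᵐᵒᵖ} (hr : r ∈ RingHom.ker (sig C E)) :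
    ∃ e : E, r = op (TrivSqZeroExt.inr e) := by
  refine ⟨(unop r).snd, ?_⟩
  apply unop_injective
  have h : (unop r).fst = 0 := op_injective hr
  ext <;> simp [h]

lemma inr_mem_ker_sig (e : E) :
    (op (TrivSqZeroExt.inr e) : (TrivSqZeroExt C E)ᵐᵒᵖ) ∈ RingHom.ker (sig C E) := by
  change op (TrivSqZeroExt.fst (TrivSqZeroExt.inr e : TrivSqZeroExt C E)) = 0
  simp

lemma ker_sq_smul {P : Type} [AddCommGroup P] [Module (TrivSqZeroExt C E)ᵐᵒᵖ P]
    (N : Submodule (TrivSqZeroExt C E)ᵐᵒᵖ P) :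
    RingHom.ker (sig C E) • (RingHom.ker (sig C E) • N) = ⊥ := by
  rw [← Submodule.mul_smul, eq_bot_iff, Submodule.smul_le]
  intro r hr n _
  have : RingHom.ker (sig C E) * RingHom.ker (sig C E) ≤ ⊥ := by
    rw [Ideal.mul_le]
    intro a ha b hb
    obtain ⟨e, rfl⟩ := mem_ker_sig C E ha
    obtain ⟨e', rfl⟩ := mem_ker_sig C E hb
    rw [← MulOpposite.op_mul]
    simp
  have hr0 : r = 0 := by simpa using this hr
  simp [hr0]

variable {C E}

/-- `P E ⊆ K E` where `K` is the kernel of `d0 : P → M`. -/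
lemma smul_top_le (hE : IsRelExt k C E) (M : Mdl Cᵐᵒᵖ) [Module.Finite Cᵐᵒᵖ M]
    (hid : IdLE1 Cᵐᵒᵖ M) {P : Mdl (TrivSqZeroExt C E)ᵐᵒᵖ} (d : P →ₛₗ[sig C E] M)
    (hd : Function.Surjective d) :
    RingHom.ker (sig C E) • (⊤ : Submodule (TrivSqZeroExt C E)ᵐᵒᵖ P)
      ≤ RingHom.ker (sig C E) • LinearMap.ker d := by
  set W := RingHom.ker (sig C E) • LinearMap.ker d with hW
  have hmem : ∀ (e : E) (y : P), d y = 0 →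
      (op (TrivSqZeroExt.inr e) : (TrivSqZeroExt C E)ᵐᵒᵖ) • y ∈ W :=
    fun e y hy => Submodule.smul_mem_smul (inr_mem_ker_sig C E e) hy
  choose t ht using hd
  have hwd : ∀ (e : E) (y y' : P), d y = d y' →
      W.mkQ ((op (TrivSqZeroExt.inr e) : (TrivSqZeroExt C E)ᵐᵒᵖ) • y)
        = W.mkQ ((op (TrivSqZeroExt.inr e) : (TrivSqZeroExt C E)ᵐᵒᵖ) • y') := by
    intro e y y' h
    rw [Submodule.mkQ_apply, Submodule.mkQ_apply, Submodule.Quotient.eq, ← smul_sub]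
    exact hmem _ _ (by rw [map_sub, h, sub_self])
  let β : M →+ E →+ (P ⧸ W) := AddMonoidHom.mk' (fun m => AddMonoidHom.mk' (fun e =>
      W.mkQ ((op (TrivSqZeroExt.inr e) : (TrivSqZeroExt C E)ᵐᵒᵖ) • t m)) (by
        intro a b
        rw [← map_add, ← add_smul, ← MulOpposite.op_add, TrivSqZeroExt.inr_add])) (by
      intro m m'
      ext e
      change W.mkQ _ = W.mkQ _ + W.mkQ _
      rw [← map_add, ← smul_add]
      exact hwd _ _ _ (by rw [map_add, ht, ht, ht]))
  have hβ : ∀ m e, β m e = W.mkQ ((op (TrivSqZeroExt.inr e) : (TrivSqZeroExt C E)ᵐᵒᵖ) • t m) :=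
    fun _ _ => rfl
  have hz := tensor_zero k C E hE M hid (P ⧸ W) β (by
    intro c m e
    rw [hβ, hβ]
    have h1 : (op (TrivSqZeroExt.inr (c • e)) : (TrivSqZeroExt C E)ᵐᵒᵖ)
        = op (TrivSqZeroExt.inr e) * op (TrivSqZeroExt.inl c) := by
      rw [← MulOpposite.op_mul, TrivSqZeroExt.inl_mul_inr]
    rw [h1, mul_smul]
    refine hwd _ _ _ ?_
    rw [map_smulₛₗ, ht, ht]
    rfl)
  rw [Submodule.smul_le]
  intro r hr p _
  obtain ⟨e, rfl⟩ := mem_ker_sig C E hr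
  have h2 := hz (d p) e
  rw [hβ, hwd e _ p (ht _), Submodule.mkQ_apply, Submodule.Quotient.mk_eq_zero] at h2
  exact h2

variable [Module k E] [IsScalarTower k C E] [IsScalarTower k Cᵐᵒᵖ E]

lemma main_aux (hE : IsRelExt k C E) (M : Mdl Cᵐᵒᵖ) [Module.Finite Cᵐᵒᵖ M]
    (hrigid : TauRigid k C M) (hid : IdLE1 Cᵐᵒᵖ M)
    (M' : Mdl (TrivSqZeroExt C E)ᵐᵒᵖ) (ι : M' →ₛₗ[sig C E] M) (hι : Function.Bijective ι) :
    TauRigid k (TrivSqZeroExt C E) M' := by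
  rintro T ⟨P1, P0, d1, d0, ⟨⟨hP0, hd0, hsup0⟩, hP1, hex, hsup1⟩, Tr, q, hq, hqk,
    φ, hφ1, hφ2, hφ3, hφ4, hφ5, -⟩ h
  have : IsNoetherianRing Cᵐᵒᵖ := IsNoetherianRing.of_finite k Cᵐᵒᵖ
  have hσ := sig_surj C E
  classical
  have hιz : ∀ x, ι x = 0 → x = 0 := fun x hx => hι.1 (by rw [hx, map_zero])
  -- superfluity
  let D : P0 →ₛₗ[sig C E] M := ι.comp d0
  have hDs : Function.Surjective D := hι.2.comp hd0
  have hDk : LinearMap.ker D = LinearMap.ker d0 := by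
    ext x
    exact ⟨fun hx => hιz _ hx, fun hx => by
      change ι (d0 x) = 0
      rw [LinearMap.mem_ker.1 hx, map_zero]⟩
  have hJ := smul_top_le k hE M hid D hDs
  rw [hDk] at hJ
  have hS : ∀ N : Submodule (TrivSqZeroExt C E)ᵐᵒᵖ P1,
      (∀ x, ∃ n ∈ N, d1 x - d1 n ∈
        RingHom.ker (sig C E) • (⊤ : Submodule (TrivSqZeroExt C E)ᵐᵒᵖ P0)) → N = ⊤ := by
    intro N hN
    have h1 : LinearMap.ker d0 ≤ N.map d1 ⊔ RingHom.ker (sig C E) • LinearMap.ker d0 := by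
      rw [← hex]
      rintro _ ⟨x, rfl⟩
      obtain ⟨n, hn, hx⟩ := hN x
      rw [← sub_add_cancel (d1 x) (d1 n), add_comm]
      exact Submodule.add_mem_sup ⟨n, hn, rfl⟩ (hex ▸ hJ hx)
    have h2 : RingHom.ker (sig C E) • LinearMap.ker d0 ≤ N.map d1 := by
      refine (Submodule.smul_mono le_rfl h1).trans ?_
      rw [Submodule.smul_sup, ker_sq_smul, sup_bot_eq]
      exact Submodule.smul_le_right
    apply hsup1
    rw [eq_top_iff]
    intro x _
    have hx : d1 x ∈ LinearMap.ker d0 := hex ▸ ⟨x, rfl⟩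
    obtain ⟨n, hn, hnx⟩ := (h1.trans (sup_le le_rfl h2)) hx
    rw [← add_sub_cancel n x]
    refine Submodule.add_mem_sup hn ?_
    rw [LinearMap.mem_ker, map_sub, hnx, sub_self]
  -- pushdown
  obtain ⟨Q0, ρ0, hρ0, hρ0k, hQ0⟩ := pushdown (sig C E) (RingHom.op (tszeInl C E))
    (fun x => rfl) P0
  obtain ⟨Q1, ρ1, hρ1, hρ1k, hQ1⟩ := pushdown (sig C E) (RingHom.op (tszeInl C E))
    (fun x => rfl) P1
  obtain ⟨δ1, hδ1⟩ := descend (sig C E) hσ ρ1 hρ1 (fun p => (hρ1k p).1) (ρ0.comp d1)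
  obtain ⟨δ0, hδ0⟩ := descend (sig C E) hσ ρ0 hρ0 (fun p => (hρ0k p).1) D
  -- P0 finite
  have hM'fin : Module.Finite (TrivSqZeroExt C E)ᵐᵒᵖ M' := by
    obtain ⟨s, hs⟩ := Module.Finite.fg_top (R := Cᵐᵒᵖ) (M := M)
    choose t ht using hι.2
    refine ⟨⟨s.image t, ?_⟩⟩
    rw [eq_top_iff]
    intro x _
    have h1 : (Submodule.span (TrivSqZeroExt C E)ᵐᵒᵖ (t '' s)).map ι = ⊤ := by
      rw [Submodule.map_span, ← Set.image_comp]
      have : ⇑ι ∘ t = id := funext ht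
      rw [this, Set.image_id, hs]
    obtain ⟨y, hy, hyx⟩ : ι x ∈ (Submodule.span (TrivSqZeroExt C E)ᵐᵒᵖ (t '' s)).map ι :=
      h1 ▸ trivial
    rw [Finset.coe_image, ← hι.1 hyx]
    exact hy
  have hP0fin : Module.Finite (TrivSqZeroExt C E)ᵐᵒᵖ P0 := by
    obtain ⟨s, hs⟩ := Module.Finite.fg_top (R := (TrivSqZeroExt C E)ᵐᵒᵖ) (M := M')
    choose t ht using hd0
    refine ⟨⟨s.image t, ?_⟩⟩
    rw [Finset.coe_image]
    apply hsup0
    rw [eq_top_iff]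
    intro x _
    have h1 : (Submodule.span (TrivSqZeroExt C E)ᵐᵒᵖ (t '' s)).map d0 = ⊤ := by
      rw [Submodule.map_span, ← Set.image_comp]
      have : ⇑d0 ∘ t = id := funext ht
      rw [this, Set.image_id, hs]
    obtain ⟨y, hy, hyx⟩ : d0 x ∈ (Submodule.span (TrivSqZeroExt C E)ᵐᵒᵖ (t '' s)).map d0 :=
      h1 ▸ trivial
    rw [← add_sub_cancel y x]
    refine Submodule.add_mem_sup hy ?_
    rw [LinearMap.mem_ker, map_sub, hyx, sub_self]
  have hQ0fin : Module.Finite Cᵐᵒᵖ Q0 := Module.Finite.of_surjective ρ0 hρ0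
  have hP1fin : Module.Finite (TrivSqZeroExt C E)ᵐᵒᵖ P1 := by
    obtain ⟨r, g, hg⟩ := Submodule.fg_iff_exists_fin_generating_family.1
      (IsNoetherian.noetherian (LinearMap.range δ1))
    have h1 : ∀ i, ∃ x, ρ0 (d1 x) = g i := by
      intro i
      obtain ⟨y, hy⟩ : g i ∈ LinearMap.range δ1 := hg ▸ Submodule.subset_span ⟨i, rfl⟩
      obtain ⟨x, rfl⟩ := hρ1 y
      exact ⟨x, by rw [← hy, hδ1]; rfl⟩
    choose t ht using h1
    refine ⟨Submodule.fg_iff_exists_fin_generating_family.2 ⟨r, t, ?_⟩⟩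
    apply hS
    intro x
    have h2 : (Submodule.span (TrivSqZeroExt C E)ᵐᵒᵖ (Set.range t)).map (ρ0.comp d1)
        = LinearMap.range δ1 := by
      rw [Submodule.map_span, ← Set.range_comp, ← hg]
      congr 2
      exact funext ht
    have h3 : ρ0 (d1 x) ∈ LinearMap.range δ1 := ⟨ρ1 x, hδ1 x⟩
    rw [← h2] at h3
    obtain ⟨n, hn, hnx⟩ := h3
    refine ⟨n, hn, (hρ0k _).1 ?_⟩
    rw [map_sub, ← hnx, LinearMap.comp_apply, sub_self]
  -- minimal presentation over C
  have hmin : IsMinPres Cᵐᵒᵖ δ1 δ0 := by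
    refine ⟨⟨hQ0 hP0, ?_, ?_⟩, hQ1 hP1, ?_, ?_⟩
    · intro m
      obtain ⟨p, rfl⟩ := hDs m
      exact ⟨ρ0 p, hδ0 p⟩
    · intro N hN
      have h1 : N.comap ρ0 = ⊤ := by
        apply hsup0
        rw [eq_top_iff]
        intro x _
        obtain ⟨a, ha, b, hb, hab⟩ := Submodule.mem_sup.1 (hN ▸ trivial : ρ0 x ∈ N ⊔ LinearMap.ker δ0)
        obtain ⟨y, rfl⟩ := hρ0 a
        rw [← add_sub_cancel y x]
        refine Submodule.add_mem_sup ha ?_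
        rw [← hDk, LinearMap.mem_ker, ← hδ0, map_sub, ← hab, add_sub_cancel_left]
        exact hb
      rw [eq_top_iff]
      intro x _
      obtain ⟨y, rfl⟩ := hρ0 x
      exact (h1 ▸ trivial : y ∈ N.comap ρ0)
    · ext x
      constructor
      · rintro ⟨y, rfl⟩
        obtain ⟨y, rfl⟩ := hρ1 y
        have h1 : d1 y ∈ LinearMap.ker d0 := hex ▸ ⟨y, rfl⟩
        rw [LinearMap.mem_ker, hδ1, LinearMap.comp_apply, hδ0]
        rw [← hDk] at h1
        exact h1
      · intro hx
        obtain ⟨y, rfl⟩ := hρ0 x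
        rw [LinearMap.mem_ker, hδ0] at hx
        have h1 : y ∈ LinearMap.ker d0 := hDk ▸ hx
        rw [← hex] at h1
        obtain ⟨z, rfl⟩ := h1
        exact ⟨ρ1 z, hδ1 z⟩
    · intro N hN
      have h1 : N.comap ρ1 = ⊤ := by
        apply hS
        intro x
        obtain ⟨a, ha, b, hb, hab⟩ := Submodule.mem_sup.1 (hN ▸ trivial : ρ1 x ∈ N ⊔ LinearMap.ker δ1)
        obtain ⟨y, rfl⟩ := hρ1 a
        refine ⟨y, ha, (hρ0k _).1 ?_⟩
        have h2 : δ1 (ρ1 (x - y)) = 0 := by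
          rw [map_sub, ← hab, add_sub_cancel_left]
          exact hb
        rw [← map_sub]
        rw [hδ1] at h2
        exact h2
      rw [eq_top_iff]
      intro x _
      obtain ⟨y, rfl⟩ := hρ1 x
      exact (h1 ▸ trivial : y ∈ N.comap ρ1)
  -- additive facts about φ
  have hφz : ∀ t, φ t 0 = 0 := fun t => by simpa using hφ2 t 0 0
  have hφz' : ∀ x, φ 0 x = 0 := fun t => by simpa using hφ1 0 0 t
  have hφsub : ∀ t x y, φ t (x - y) = φ t x - φ t y := fun t x y => by
    rw [eq_sub_iff_add_eq, ← hφ2, sub_add_cancel]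
  have hφsum : ∀ t (n : ℕ) (f : Fin n → Tr), φ t (∑ i, f i) = ∑ i, φ t (f i) := fun t n f =>
    map_sum (AddMonoidHom.mk' (φ t) (hφ2 t)) f Finset.univ
  -- maps into E pair to zero
  have hfst : ∀ (m : M') (g : P1 →ₗ[(TrivSqZeroExt C E)ᵐᵒᵖ] TrivSqZeroExt C E),
      (∀ p, (g p).fst = 0) → φ (h m) (q g) = 0 := by
    intro m g hg
    obtain ⟨n, f, i, -, -, hfi⟩ := Module.Finite.exists_comp_eq_id_of_projective
      (TrivSqZeroExt C E)ᵐᵒᵖ P1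
    let xs : Fin n → (P1 →ₗ[(TrivSqZeroExt C E)ᵐᵒᵖ] TrivSqZeroExt C E) := fun j =>
      (unopR _).comp ((LinearMap.proj j).comp i)
    have hgs : g = ∑ j, g (f (Pi.single j 1)) • xs j := by
      ext1 p
      have h2 : i p = ∑ j, i p j • (Pi.single j (1 : (TrivSqZeroExt C E)ᵐᵒᵖ)
          : Fin n → (TrivSqZeroExt C E)ᵐᵒᵖ) := by
        ext1 j; simp [Finset.sum_apply, Pi.single_apply]
      have h3 : p = f (i p) := (LinearMap.congr_fun hfi p).symm
      conv_lhs => rw [h3, h2]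
      rw [map_sum, map_sum, LinearMap.sum_apply]
      refine Finset.sum_congr rfl fun j _ => ?_
      rw [map_smul, map_smul]
      rfl
    rw [hgs, map_sum, hφsum]
    refine Finset.sum_eq_zero fun j _ => ?_
    rw [map_smul, ← hφ4, ← map_smul]
    have h4 : op (g (f (Pi.single j 1))) • m = 0 := by
      apply hιz
      rw [map_smulₛₗ]
      have : sig C E (op (g (f (Pi.single j 1)))) = 0 := congrArg op (hg _)
      rw [this, zero_smul]
    rw [h4, map_zero, hφz']
  -- the transpose over C
  let Z : Submodule C (Q1 →ₗ[Cᵐᵒᵖ] C) :=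
    { carrier := {g | ∃ f : Q0 →ₗ[Cᵐᵒᵖ] C, g = f.comp δ1}
      add_mem' := by
        rintro _ _ ⟨a, rfl⟩ ⟨b, rfl⟩
        exact ⟨a + b, rfl⟩
      zero_mem' := ⟨0, rfl⟩
      smul_mem' := by
        rintro c _ ⟨a, rfl⟩
        exact ⟨c • a, rfl⟩ }
  obtain ⟨Tr0, q0, hq0, hq0k⟩ : ∃ (Tr0 : Mdl C) (q0 : (Q1 →ₗ[Cᵐᵒᵖ] C) →ₗ[C] Tr0),
      Function.Surjective q0 ∧
      ∀ g : Q1 →ₗ[Cᵐᵒᵖ] C, q0 g = 0 ↔ ∃ f : Q0 →ₗ[Cᵐᵒᵖ] C, g = f.comp δ1 :=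
    ⟨ModuleCat.of C ((Q1 →ₗ[Cᵐᵒᵖ] C) ⧸ Z), Z.mkQ, Z.mkQ_surjective,
      fun g => Submodule.Quotient.mk_eq_zero Z⟩
  obtain ⟨T0, hT0, huniv⟩ := exists_dual k C Tr0
  have hzero : HomZero Cᵐᵒᵖ M T0 :=
    hrigid T0 ⟨Q1, Q0, δ1, δ0, hmin, Tr0, q0, hq0, hq0k, hT0⟩
  -- lifting and reducing functionals
  let fs : TrivSqZeroExt C E →ₛₗ[sig C E] C :=
    { toFun := fun b => b.fst
      map_add' := fun _ _ => rfl
      map_smul' := fun _ _ => rfl }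
  have hfs : Function.Surjective fs := fun c => ⟨TrivSqZeroExt.inl c, rfl⟩
  have hlift1 : ∀ g0 : Q1 →ₗ[Cᵐᵒᵖ] C, ∃ g : P1 →ₗ[(TrivSqZeroExt C E)ᵐᵒᵖ] TrivSqZeroExt C E,
      ∀ p, (g p).fst = g0 (ρ1 p) := fun g0 => semilift (sig C E) fs hfs (g0.comp ρ1)
  have hlift0 : ∀ g0 : Q0 →ₗ[Cᵐᵒᵖ] C, ∃ g : P0 →ₗ[(TrivSqZeroExt C E)ᵐᵒᵖ] TrivSqZeroExt C E,
      ∀ p, (g p).fst = g0 (ρ0 p) := fun g0 => semilift (sig C E) fs hfs (g0.comp ρ0)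
  have hred : ∀ g : P1 →ₗ[(TrivSqZeroExt C E)ᵐᵒᵖ] TrivSqZeroExt C E, ∃ g0 : Q1 →ₗ[Cᵐᵒᵖ] C,
      ∀ p, (g p).fst = g0 (ρ1 p) := by
    intro g
    obtain ⟨g0, hg0⟩ := descend (sig C E) hσ ρ1 hρ1 (fun p => (hρ1k p).1) (fs.comp g)
    exact ⟨g0, fun p => (hg0 p).symm⟩
  have hW : ∀ (g : P1 →ₗ[(TrivSqZeroExt C E)ᵐᵒᵖ] TrivSqZeroExt C E) (g0 : Q1 →ₗ[Cᵐᵒᵖ] C),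
      (∀ p, (g p).fst = g0 (ρ1 p)) → q0 g0 = 0 → ∀ m, φ (h m) (q g) = 0 := by
    intro g g0 hg h0 m
    obtain ⟨u0, rfl⟩ := (hq0k _).1 h0
    obtain ⟨u, hu⟩ := hlift0 u0
    have h1 : q (u.comp d1) = 0 := (hqk _).2 ⟨u, rfl⟩
    have h2 := hfst m (g - u.comp d1) (by
      intro p
      have : δ1 (ρ1 p) = ρ0 (d1 p) := hδ1 p
      simp [hg, hu, this])
    rwa [map_sub, h1, sub_zero] at h2
  have hG : ∀ x : Tr0, ∃ (g : P1 →ₗ[(TrivSqZeroExt C E)ᵐᵒᵖ] TrivSqZeroExt C E)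
      (g0 : Q1 →ₗ[Cᵐᵒᵖ] C), (∀ p, (g p).fst = g0 (ρ1 p)) ∧ q0 g0 = x := by
    intro x
    obtain ⟨g0, rfl⟩ := hq0 x
    obtain ⟨g, hg⟩ := hlift1 g0
    exact ⟨g, g0, hg, rfl⟩
  choose G G0 hGG hGx using hG
  choose j hj using hι.2
  have hjadd : ∀ a b, j (a + b) = j a + j b := fun a b => hι.1 (by rw [map_add, hj, hj, hj])
  have hjsmul : ∀ (c : C) a, j (op c • a) =
      (op (TrivSqZeroExt.inl c) : (TrivSqZeroExt C E)ᵐᵒᵖ) • j a :=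
    fun c a => hι.1 (by rw [map_smulₛₗ, hj, hj]; rfl)
  have hψ := huniv M (fun m x => φ (h (j m)) (q (G x)))
    (by
      intro n n' x
      change φ (h (j (n + n'))) _ = _
      rw [hjadd, map_add, hφ1])
    (by
      intro n x y
      change φ (h (j n)) (q (G (x + y))) = φ (h (j n)) (q (G x)) + φ (h (j n)) (q (G y))
      rw [← hφ2, ← map_add, ← sub_eq_zero, ← hφsub, ← map_sub]
      refine hW _ (G0 (x + y) - (G0 x + G0 y)) (fun p => by simp [hGG]) ?_ _
      rw [map_sub, map_add, hGx, hGx, hGx, sub_self])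
    (by
      intro c n x
      change φ (h (j n)) (q (G (algebraMap k C c • x))) = c * φ (h (j n)) (q (G x))
      rw [← hφ3, ← map_smul, ← sub_eq_zero, ← hφsub, ← map_sub]
      refine hW _ (G0 (algebraMap k C c • x) - algebraMap k C c • G0 x) (fun p => ?_) ?_ _
      · have : (algebraMap k (TrivSqZeroExt C E) c).fst = algebraMap k C c := rfl
        simp [hGG, this]
      · rw [map_sub, map_smul, hGx, hGx, sub_self])
    (by
      intro c n x
      change φ (h (j (op c • n))) (q (G x)) = φ (h (j n)) (q (G (c • x)))
      rw [hjsmul, map_smul, hφ4, ← map_smul, ← sub_eq_zero, ← hφsub, ← map_sub]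
      refine hW _ (c • G0 x - G0 (c • x)) (fun p => by simp [hGG]) ?_ _
      rw [map_sub, map_smul, hGx, hGx, sub_self])
    hzero
  apply LinearMap.ext
  intro m
  apply hφ5
  intro t
  obtain ⟨g, rfl⟩ := hq t
  obtain ⟨g0, hg0⟩ := hred g
  have h1 : φ (h (j (ι m))) (q (G (q0 g0))) = 0 := hψ (ι m) (q0 g0)
  have h2 : j (ι m) = m := hι.1 (hj _)
  rw [h2] at h1
  have h3 := hW (g - G (q0 g0)) (g0 - G0 (q0 g0)) (fun p => by simp [hGG, hg0])
    (by rw [map_sub, hGx, sub_self]) m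
  rw [map_sub, hφsub, h1, sub_zero] at h3
  exact h3

end Main

end Helpers

/-- If `M` is `τ_C`-rigid with `id_C M ≤ 1`, then `M` is `τ_B`-rigid over the
relation extension `B = C ⋉ Ext²(DC, C)`. -/
theorem tauB_rigid_of_id_le_one
    (k : Type) [Field k] (C : Type) [Ring C] [Algebra k C] [FiniteDimensional k C]
    (E : Type) [AddCommGroup E] [Module C E] [Module Cᵐᵒᵖ E] [SMulCommClass C Cᵐᵒᵖ E]
    [Module k E] [IsScalarTower k C E] [IsScalarTower k Cᵐᵒᵖ E]
    (hgl : GlDimEq2 Cᵐᵒᵖ) (hE : IsRelExt k C E)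
    (M : Mdl Cᵐᵒᵖ) [Module.Finite Cᵐᵒᵖ M]
    (hrigid : TauRigid k C M) (hid : IdLE1 Cᵐᵒᵖ M) :
    TauRigid k (TrivSqZeroExt C E) (modB C E M) := by
  exact main_aux k hE M hrigid hid (modB C E M)
    { toFun := fun m => m
      map_add' := fun _ _ => rfl
      map_smul' := fun _ _ => rfl } Function.bijective_id
end
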